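/- arXiv:2504.20968 — 4 statements merged into one kernel-verified Lean document; each statement's English description precedes it below -/
import Mathlib

section
/- If X = (V, E) is a tournament, then for every coloring f : V → ℤ⁺, the number of (f, X)-friendly V-listings equals the number of (f, X̄)-friendly V-listings, i.e. N(f, X) = N(f, X̄). (Equivalently, W_X = W_{X̄} for tournaments.) -/
/-- A `V`-listing `σ` (a bijection `Fin n ≃ V`) is `(f, X)`-friendly for the digraph with
edge set `E` and the coloring `f` if the colors are weakly increasing along the listing,
and strictly increase along every edge of the digraph. -/
def Friendly {V : Type*} [Fintype V] (E : Set (V × V)) (f : V → ℕ+)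
    (σ : Fin (Fintype.card V) ≃ V) : Prop :=
  Monotone (fun i => f (σ i)) ∧
  ∀ i : Fin (Fintype.card V), ∀ h : (i : ℕ) + 1 < Fintype.card V,
    (σ i, σ ⟨(i : ℕ) + 1, h⟩) ∈ E → f (σ i) < f (σ ⟨(i : ℕ) + 1, h⟩)

/-- `redeiBergeCount E f` is `N(f, X)`, the number of `(f, X)`-friendly `V`-listings
of the digraph `X = (V, E)`. -/
noncomputable def redeiBergeCount {V : Type*} [Fintype V] (E : Set (V × V)) (f : V → ℕ+) : ℕ :=
  Nat.card {σ : Fin (Fintype.card V) ≃ V // Friendly E f σ}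

theorem rb_lower {n : ℕ} (S : Finset (Fin n)) (hS : ∀ i j : Fin n, i ≤ j → j ∈ S → i ∈ S)
    (j : Fin n) : (j : ℕ) < S.card ↔ j ∈ S := by
  constructor
  · intro h
    by_contra hj
    have hsub : S ⊆ Finset.Iio j := by
      intro i hi
      rw [Finset.mem_Iio]
      by_contra hlt
      exact hj (hS j i (not_lt.mp hlt) hi)
    have := Finset.card_le_card hsub
    rw [Fin.card_Iio] at this
    omega
  · intro h
    have hsub : Finset.Iic j ⊆ S := by
      intro i hi
      exact hS i j (Finset.mem_Iic.mp hi) h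
    have := Finset.card_le_card hsub
    rw [Fin.card_Iic] at this
    omega

/-- Existence of the reversal of every color block of a weakly increasing sequence. -/
theorem rb_rev {n : ℕ} (g : Fin n → ℕ+) (hg : Monotone g) :
    ∃ r : Equiv.Perm (Fin n), (∀ i, g (r i) = g i) ∧
      ∀ i j : Fin n, (j : ℕ) = i + 1 → g i = g j → ((r i : Fin n) : ℕ) = (r j : ℕ) + 1 := by
  obtain ⟨L, hL⟩ : ∃ L : ℕ+ → ℕ, ∀ c (j : Fin n), (j : ℕ) < L c ↔ g j < c :=
    ⟨fun c => (Finset.univ.filter (fun j => g j < c)).card, fun c j => by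
      rw [rb_lower _ _ j]
      · simp
      · intro i j hij hj
        simp only [Finset.mem_filter, Finset.mem_univ, true_and] at hj ⊢
        exact lt_of_le_of_lt (hg hij) hj⟩
  obtain ⟨H, hH, hHn⟩ : ∃ H : ℕ+ → ℕ, (∀ c (j : Fin n), (j : ℕ) < H c ↔ g j ≤ c) ∧
      ∀ c, H c ≤ n :=
    ⟨fun c => (Finset.univ.filter (fun j => g j ≤ c)).card, fun c j => by
      rw [rb_lower _ _ j]
      · simp
      · intro i j hij hj
        simp only [Finset.mem_filter, Finset.mem_univ, true_and] at hj ⊢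
        exact le_trans (hg hij) hj, fun c => by
      simpa using Finset.card_le_univ (Finset.univ.filter (fun j => g j ≤ c))⟩
  have h1 : ∀ i : Fin n, L (g i) ≤ i := fun i => by
    by_contra h
    exact lt_irrefl _ ((hL (g i) i).mp (not_le.mp h))
  have h2 : ∀ i : Fin n, (i : ℕ) < H (g i) := fun i => (hH (g i) i).mpr le_rfl
  let r : Fin n → Fin n := fun i => ⟨L (g i) + H (g i) - 1 - i, by
    have := h1 i; have := h2 i; have := hHn (g i); omega⟩
  have hr : ∀ i, ((r i : Fin n) : ℕ) = L (g i) + H (g i) - 1 - i := fun i => rfl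
  have hgr : ∀ i, g (r i) = g i := fun i => by
    have a := h1 i
    have b := h2 i
    apply le_antisymm
    · rw [← hH, hr]; omega
    · rw [← not_lt, ← hL, hr]; omega
  have hinv : Function.Involutive r := fun i => by
    have a := h1 i
    have b := h2 i
    apply Fin.ext
    rw [hr, hgr, hr]; omega
  refine ⟨hinv.toPerm r, hgr, fun i j hij hc => ?_⟩
  have a := h1 i
  have b := h2 j
  show ((r i : Fin n) : ℕ) = (r j : ℕ) + 1
  rw [hr, hr, ← hc]
  rw [← hc] at b
  omega

theorem rb_le {V : Type*} [Fintype V] (E E' : Set (V × V))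
    (h : ∀ u v : V, u ≠ v → (u, v) ∉ E → (v, u) ∉ E') (f : V → ℕ+) :
    redeiBergeCount E f ≤ redeiBergeCount E' f := by
  choose r hr1 hr2 using @rb_rev (Fintype.card V)
  unfold redeiBergeCount
  refine Nat.card_le_card_of_injective
    (fun s => ⟨(r (fun i => f (s.1 i)) s.2.1).trans s.1, ?_, ?_⟩) ?_
  · have : (fun i => f (((r (fun i => f (s.1 i)) s.2.1).trans s.1) i)) = fun i => f (s.1 i) := by
      funext i
      exact hr1 _ s.2.1 i
    rw [this]
    exact s.2.1
  · intro i hi hE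
    have e1 := hr1 _ s.2.1 i
    have e2 := hr1 _ s.2.1 ⟨i + 1, hi⟩
    have e3 := hr2 _ s.2.1 i ⟨i + 1, hi⟩ rfl
    simp only [Equiv.trans_apply] at hE ⊢
    rw [e1, e2]
    refine lt_of_le_of_ne (s.2.1 (Fin.le_def.mpr (Nat.le_succ _))) fun hc => ?_
    have e4 := e3 hc
    generalize (r (fun i => f (s.1 i)) s.2.1) i = a at *
    generalize (r (fun i => f (s.1 i)) s.2.1) ⟨i + 1, hi⟩ = b at *
    have hb : (b : ℕ) + 1 < Fintype.card V := e4 ▸ a.2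
    have hab : a = ⟨b + 1, hb⟩ := Fin.ext e4
    have hfr := s.2.2 b hb
    rw [← hab] at hfr
    refine h (s.1 b) (s.1 a) ?_ ?_ hE
    · intro hh
      have := s.1.injective hh
      rw [this] at e4
      omega
    · intro hm
      have := hfr hm
      rw [e1, e2, hc] at this
      exact lt_irrefl _ this
  · rintro ⟨s, hs⟩ ⟨t, ht⟩ hst
    have hst' := congrArg Subtype.val hst
    simp only at hst'
    have hg : (fun i => f (s i)) = fun i => f (t i) := by
      funext i
      have a := hr1 _ hs.1 i
      have b := hr1 _ ht.1 i
      have c := congrArg f (DFunLike.congr_fun hst' i)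
      simp only [Equiv.trans_apply] at a b c
      rw [← a, ← b, c]
    have hrr : r (fun i => f (s i)) hs.1 = r (fun i => f (t i)) ht.1 := by
      congr 1
    rw [hrr] at hst'
    apply Subtype.ext
    apply Equiv.ext
    intro i
    have := DFunLike.congr_fun hst' ((r (fun i => f (t i)) ht.1).symm i)
    simpa using this

/-- If `X = (V, E)` is a tournament (loopless, and for distinct `u, v` exactly one of
`(u, v)`, `(v, u)` is an edge), then for every coloring `f`, the number of friendly
listings for `X` equals the number of friendly listings for the complement `X̄`. -/
theorem redeiBergeCount_compl_of_tournament {V : Type*} [Fintype V] (E : Set (V × V))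
    (hloopless : ∀ v : V, (v, v) ∉ E)
    (htour : ∀ u v : V, u ≠ v → ((u, v) ∈ E ↔ (v, u) ∉ E))
    (f : V → ℕ+) :
    redeiBergeCount E f = redeiBergeCount Eᶜ f := by
  refine le_antisymm (rb_le _ _ ?_ f) (rb_le _ _ ?_ f)
  · intro u v huv hE
    simpa using (htour v u huv.symm).mpr hE
  · intro u v huv hE
    exact (htour u v huv).mp (by simpa using hE)
end

section
/- For any two digraphs X = (V, E) and Y = (V', E') on disjoint vertex sets and every coloring h : V ⊔ V' → ℤ⁺, the number of (h, X·Y)-friendly listings of V ⊔ V' equals the product N(h|_V, X) · N(h|_{V'}, Y) of the numbers of friendly listings of the restrictions. (Equivalently, W_{X·Y} = W_X · W_Y.) -/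
/-- The edge set of the product digraph `X · Y`: it keeps all edges of `X` and of `Y`,
and adds every edge from a vertex of `X` to a vertex of `Y`. -/
def prodEdges {V V' : Type*} (E : Set (V × V)) (E' : Set (V' × V')) :
    Set ((V ⊕ V') × (V ⊕ V')) :=
  {p | match p with
    | (Sum.inl u, Sum.inl v) => (u, v) ∈ E
    | (Sum.inr u, Sum.inr v) => (u, v) ∈ E'
    | (Sum.inl _, Sum.inr _) => True
    | (Sum.inr _, Sum.inl _) => False}

/-- The step relation of a friendly listing. -/
def RBStep {V : Type*} (E : Set (V × V)) (f : V → ℕ+) (a b : V) : Prop :=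
  f a ≤ f b ∧ ((a, b) ∈ E → f a < f b)

/-- Friendly listings as lists. -/
def RBList {V : Type*} (E : Set (V × V)) (f : V → ℕ+) (l : List V) : Prop :=
  l.Nodup ∧ (∀ x, x ∈ l) ∧ l.IsChain (RBStep E f)

theorem friendly_iff_list {V : Type*} [Fintype V] (E : Set (V × V)) (f : V → ℕ+)
    (σ : Fin (Fintype.card V) ≃ V) : Friendly E f σ ↔ RBList E f (List.ofFn σ) := by
  have h1 : (List.ofFn σ).Nodup := List.nodup_ofFn.2 σ.injective
  have h2 : ∀ x, x ∈ List.ofFn σ := fun x => (List.mem_ofFn' σ x).2 (σ.surjective x)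
  constructor
  · rintro ⟨hm, he⟩
    refine ⟨h1, h2, ?_⟩
    rw [List.isChain_iff_getElem]
    intro i hi
    simp only [List.length_ofFn] at hi
    simp only [List.getElem_ofFn]
    exact ⟨hm (by simp [Fin.le_def]), he ⟨i, by omega⟩ hi⟩
  · rintro ⟨-, -, hc⟩
    constructor
    · have hc' : (List.ofFn σ).IsChain (fun a b => f a ≤ f b) := hc.imp (fun _ _ h => h.1)
      have : IsTrans V (fun a b => f a ≤ f b) := ⟨fun _ _ _ => le_trans⟩
      have hp := List.isChain_iff_pairwise.1 hc'
      rw [List.pairwise_ofFn] at hp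
      intro i j hij
      rcases hij.lt_or_eq with h | h
      · exact hp h
      · rw [h]
    · intro i hi
      rw [List.isChain_iff_getElem] at hc
      have := hc i (by simpa using hi)
      simp only [List.getElem_ofFn] at this
      exact this.2

theorem redeiBergeCount_eq_list {V : Type*} [Fintype V] (E : Set (V × V)) (f : V → ℕ+) :
    redeiBergeCount E f = Nat.card {l : List V // RBList E f l} := by
  classical
  unfold redeiBergeCount
  refine Nat.card_eq_of_bijective
    (fun σ => ⟨List.ofFn σ.1, (friendly_iff_list E f σ.1).1 σ.2⟩) ⟨?_, ?_⟩
  · intro σ τ h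
    have := List.ofFn_injective (Subtype.mk.inj h)
    exact Subtype.ext (DFunLike.coe_injective this)
  · rintro ⟨l, hl⟩
    have e := hl.1.getEquivOfForallMemList l hl.2.1
    have hlen : Fintype.card V = l.length := by
      rw [← Fintype.card_congr e, Fintype.card_fin]
    have key : List.ofFn ((finCongr hlen).trans (hl.1.getEquivOfForallMemList l hl.2.1)) = l := by
      apply List.ext_getElem
      · simp [hlen]
      · intro i h1 h2
        simp
    refine ⟨⟨(finCongr hlen).trans (hl.1.getEquivOfForallMemList l hl.2.1), ?_⟩, ?_⟩
    · rw [friendly_iff_list, key]; exact hl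
    · exact Subtype.ext key

section merging
variable {V V' : Type*}

def rbL (l : List (V ⊕ V')) : List V := l.filterMap Sum.getLeft?

/-- Right parts. -/
def rbR (l : List (V ⊕ V')) : List V' := l.filterMap Sum.getRight?

/-- Merge by color, ties put the right part first. -/
def rbM (h : V ⊕ V' → ℕ+) : List V → List V' → List (V ⊕ V')
  | [], b => b.map Sum.inr
  | a, [] => a.map Sum.inl
  | x :: a, y :: b =>
    if h (Sum.inr y) ≤ h (Sum.inl x) then Sum.inr y :: rbM h (x :: a) b
    else Sum.inl x :: rbM h a (y :: b)
termination_by a b => a.length + b.length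

theorem rbM_nil (h : V ⊕ V' → ℕ+) (a : List V) : rbM h a [] = a.map Sum.inl := by
  cases a <;> simp [rbM]

theorem rbM_nil' (h : V ⊕ V' → ℕ+) (b : List V') : rbM h [] b = b.map Sum.inr := by
  simp [rbM]

theorem rbM_cons (h : V ⊕ V' → ℕ+) (x : V) (a : List V) (y : V') (b : List V') :
    rbM h (x :: a) (y :: b) =
    if h (Sum.inr y) ≤ h (Sum.inl x) then Sum.inr y :: rbM h (x :: a) b
    else Sum.inl x :: rbM h a (y :: b) := by
  rw [rbM]

theorem rbL_map_inl (a : List V) : rbL (a.map (Sum.inl : V → V ⊕ V')) = a := by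
  induction a <;> simp_all [rbL]
theorem rbL_map_inr (a : List V') : rbL (a.map (Sum.inr : V' → V ⊕ V')) = [] := by
  induction a <;> simp_all [rbL]
theorem rbR_map_inl (a : List V) : rbR (a.map (Sum.inl : V → V ⊕ V')) = [] := by
  induction a <;> simp_all [rbR]
theorem rbR_map_inr (a : List V') : rbR (a.map (Sum.inr : V' → V ⊕ V')) = a := by
  induction a <;> simp_all [rbR]
theorem rbL_inl (x : V) (l : List (V ⊕ V')) : rbL (Sum.inl x :: l) = x :: rbL l := by simp [rbL]
theorem rbL_inr (x : V') (l : List (V ⊕ V')) : rbL (Sum.inr x :: l) = rbL l := rfl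
theorem rbR_inl (x : V) (l : List (V ⊕ V')) : rbR (Sum.inl x :: l) = rbR l := rfl
theorem rbR_inr (x : V') (l : List (V ⊕ V')) : rbR (Sum.inr x :: l) = x :: rbR l := by simp [rbR]
theorem mem_rbL (x : V) (l : List (V ⊕ V')) : x ∈ rbL l ↔ Sum.inl x ∈ l := by
  simp [rbL]
theorem mem_rbR (x : V') (l : List (V ⊕ V')) : x ∈ rbR l ↔ Sum.inr x ∈ l := by
  simp [rbR]

theorem rb_merge (E : Set (V × V)) (E' : Set (V' × V')) (h : V ⊕ V' → ℕ+) (n : ℕ) :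
    ∀ (a : List V) (b : List V'), a.length + b.length = n →
    a.IsChain (RBStep E (h ∘ Sum.inl)) → b.IsChain (RBStep E' (h ∘ Sum.inr)) →
    rbL (rbM h a b) = a ∧ rbR (rbM h a b) = b ∧
    (rbM h a b).IsChain (RBStep (prodEdges E E') h) ∧
    (∀ z ∈ (rbM h a b).head?, (∃ x ∈ a.head?, z = Sum.inl x) ∨ (∃ y ∈ b.head?, z = Sum.inr y)) := by
  induction n with
  | zero =>
    intro a b hn _ _
    have ha : a = [] := List.length_eq_zero_iff.1 (by omega)
    have hb : b = [] := List.length_eq_zero_iff.1 (by omega)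
    subst ha hb
    simp [rbM, rbL, rbR]
  | succ n ih =>
    intro a b hn ha hb
    rcases a with _ | ⟨x, a⟩
    · rw [rbM_nil']
      refine ⟨rbL_map_inr _, rbR_map_inr _, ?_, ?_⟩
      · rw [List.isChain_map]; exact hb
      · cases b <;> simp
    rcases b with _ | ⟨y, b⟩
    · rw [rbM_nil]
      refine ⟨rbL_map_inl _, rbR_map_inl _, ?_, ?_⟩
      · rw [List.isChain_map]; exact ha
      · simp
    rw [rbM_cons]
    split_ifs with hxy
    · obtain ⟨i1, i2, i3, i4⟩ := ih (x :: a) b (by simp at hn ⊢; omega) ha hb.tail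
      refine ⟨by rw [rbL_inr, i1], by rw [rbR_inr, i2], ?_, by simp⟩
      rw [List.isChain_cons]
      refine ⟨fun z hz => ?_, i3⟩
      rcases i4 z hz with ⟨w, hw, rfl⟩ | ⟨w, hw, rfl⟩
      · simp at hw; subst hw
        exact ⟨hxy, fun h => h.elim⟩
      · exact (List.isChain_cons.1 hb).1 w hw
    · obtain ⟨i1, i2, i3, i4⟩ := ih a (y :: b) (by simp at hn ⊢; omega) ha.tail hb
      refine ⟨by rw [rbL_inl, i1], by rw [rbR_inl, i2], ?_, by simp⟩
      rw [List.isChain_cons]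
      refine ⟨fun z hz => ?_, i3⟩
      rcases i4 z hz with ⟨w, hw, rfl⟩ | ⟨w, hw, rfl⟩
      · exact (List.isChain_cons.1 ha).1 w hw
      · simp at hw; subst hw
        exact ⟨(not_le.1 hxy).le, fun _ => not_le.1 hxy⟩

/-- Transitive consequence of the step relation. -/
def RBS (h : V ⊕ V' → ℕ+) (p q : V ⊕ V') : Prop :=
  h p ≤ h q ∧ (p.isLeft → q.isRight → h p < h q)

theorem rbs_trans (h : V ⊕ V' → ℕ+) : IsTrans (V ⊕ V') (RBS h) := by
  constructor
  rintro p q r ⟨h1, h2⟩ ⟨h3, h4⟩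
  refine ⟨h1.trans h3, fun hp hr => ?_⟩
  rcases q with q | q
  · exact lt_of_le_of_lt h1 (h4 rfl hr)
  · exact lt_of_lt_of_le (h2 hp rfl) h3

theorem rbs_pairwise (E : Set (V × V)) (E' : Set (V' × V')) (h : V ⊕ V' → ℕ+)
    (l : List (V ⊕ V')) (hl : l.IsChain (RBStep (prodEdges E E') h)) : l.Pairwise (RBS h) := by
  have := rbs_trans h
  rw [← List.isChain_iff_pairwise]
  refine hl.imp ?_
  rintro (p | p) (q | q) ⟨h1, h2⟩
  · exact ⟨h1, by simp⟩
  · exact ⟨h1, fun _ _ => h2 trivial⟩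
  · exact ⟨h1, by simp⟩
  · exact ⟨h1, by simp⟩

theorem rb_split (E : Set (V × V)) (E' : Set (V' × V')) (h : V ⊕ V' → ℕ+)
    (l : List (V ⊕ V')) (hl : l.IsChain (RBStep (prodEdges E E') h)) :
    (rbL l).IsChain (RBStep E (h ∘ Sum.inl)) ∧ (rbR l).IsChain (RBStep E' (h ∘ Sum.inr)) ∧
    rbM h (rbL l) (rbR l) = l := by
  induction l with
  | nil => simp [rbL, rbR, rbM]
  | cons p l ih =>
    obtain ⟨i1, i2, i3⟩ := ih hl.tail
    have hp := rbs_pairwise E E' h _ hl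
    have hp1 := List.pairwise_cons.1 hp
    have hc := (List.isChain_cons.1 hl).1
    rcases p with x | y
    · rw [rbL_inl, rbR_inl]
      refine ⟨List.isChain_cons.2 ⟨fun z hz => ?_, i1⟩, i2, ?_⟩
      · have hz' : Sum.inl z ∈ l := (mem_rbL z l).1 (List.mem_of_mem_head? hz)
        rcases l with _ | ⟨w | w, l⟩
        · simp at hz'
        · rw [rbL_inl] at hz
          simp at hz; subst hz
          exact hc _ (by simp)
        · have e1 : h (Sum.inl x) < h (Sum.inr w) := (hp1.1 _ (by simp)).2 rfl rfl
          have e2 : h (Sum.inr w) ≤ h (Sum.inl z) :=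
            ((List.pairwise_cons.1 hp1.2).1 _ (by simpa using hz')).1
          exact ⟨(e1.trans_le e2).le, fun _ => e1.trans_le e2⟩
      · rcases hr : rbR l with _ | ⟨z, r⟩
        · rw [hr, rbM_nil] at i3
          rw [rbM_nil, List.map_cons, i3]
        · have hz : Sum.inr z ∈ l := (mem_rbR z l).1 (by simp [hr])
          have e1 : h (Sum.inl x) < h (Sum.inr z) := (hp1.1 _ hz).2 rfl rfl
          rw [rbM_cons, if_neg (not_le.2 e1), ← hr, i3]
    · rw [rbL_inr, rbR_inr]
      refine ⟨i1, List.isChain_cons.2 ⟨fun z hz => ?_, i2⟩, ?_⟩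
      · have hz' : Sum.inr z ∈ l := (mem_rbR z l).1 (List.mem_of_mem_head? hz)
        rcases l with _ | ⟨w | w, l⟩
        · simp at hz'
        · have e1 : h (Sum.inr y) ≤ h (Sum.inl w) := (hp1.1 _ (by simp)).1
          have e2 : h (Sum.inl w) < h (Sum.inr z) :=
            ((List.pairwise_cons.1 hp1.2).1 _ (by simpa using hz')).2 rfl rfl
          exact ⟨(e1.trans_lt e2).le, fun _ => e1.trans_lt e2⟩
        · rw [rbR_inr] at hz
          simp at hz; subst hz
          exact hc _ (by simp)
      · rcases hr : rbL l with _ | ⟨z, r⟩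
        · rw [hr, rbM_nil'] at i3
          rw [rbM_nil', List.map_cons, i3]
        · have hz : Sum.inl z ∈ l := (mem_rbL z l).1 (by simp [hr])
          have e1 : h (Sum.inr y) ≤ h (Sum.inl z) := (hp1.1 _ hz).1
          rw [rbM_cons, if_pos e1, ← hr, i3]

theorem rb_nodup (l : List (V ⊕ V')) : l.Nodup ↔ (rbL l).Nodup ∧ (rbR l).Nodup := by
  induction l with
  | nil => simp [rbL, rbR]
  | cons p l ih =>
    rcases p with x | y
    · rw [rbL_inl, rbR_inl, List.nodup_cons, List.nodup_cons, ih, mem_rbL]; tauto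
    · rw [rbL_inr, rbR_inr, List.nodup_cons, List.nodup_cons, ih, mem_rbR]; tauto

end merging

/-- For digraphs `X = (V, E)` and `Y = (V', E')` on disjoint vertex sets and any coloring
`h` of `V ⊔ V'`, the number of friendly listings of the product digraph `X · Y` is the
product of the numbers of friendly listings of `X` and of `Y` for the restricted colorings. -/
theorem redeiBergeCount_prod {V V' : Type*} [Fintype V] [Fintype V']
    (E : Set (V × V)) (E' : Set (V' × V')) (h : V ⊕ V' → ℕ+) :
    redeiBergeCount (prodEdges E E') h =
      redeiBergeCount E (h ∘ Sum.inl) * redeiBergeCount E' (h ∘ Sum.inr) := by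
  rw [redeiBergeCount_eq_list, redeiBergeCount_eq_list, redeiBergeCount_eq_list, ← Nat.card_prod]
  refine Nat.card_congr
    { toFun := fun l => (⟨rbL l.1, ?_⟩, ⟨rbR l.1, ?_⟩)
      invFun := fun q => ⟨rbM h q.1.1 q.2.1, ?_⟩
      left_inv := ?_
      right_inv := ?_ }
  · obtain ⟨l, h1, h2, h3⟩ := l
    exact ⟨((rb_nodup l).1 h1).1, fun x => (mem_rbL x l).2 (h2 _), (rb_split E E' h l h3).1⟩
  · obtain ⟨l, h1, h2, h3⟩ := l
    exact ⟨((rb_nodup l).1 h1).2, fun x => (mem_rbR x l).2 (h2 _), (rb_split E E' h l h3).2.1⟩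
  · obtain ⟨⟨a, a1, a2, a3⟩, ⟨b, b1, b2, b3⟩⟩ := q
    obtain ⟨m1, m2, m3, -⟩ := rb_merge E E' h _ a b rfl a3 b3
    refine ⟨(rb_nodup _).2 ⟨by rwa [m1], by rwa [m2]⟩, ?_, m3⟩
    rintro (x | y)
    · rw [← mem_rbL, m1]; exact a2 x
    · rw [← mem_rbR, m2]; exact b2 y
  · rintro ⟨l, h1, h2, h3⟩
    exact Subtype.ext (rb_split E E' h l h3).2.2
  · rintro ⟨⟨a, a1, a2, a3⟩, ⟨b, b1, b2, b3⟩⟩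
    obtain ⟨m1, m2, m3, -⟩ := rb_merge E E' h _ a b rfl a3 b3
    exact Prod.ext (Subtype.ext m1) (Subtype.ext m2)
end

section
/- If X = (V, E) is a digraph in which every directed cycle has odd length, then for every coloring f : V → ℤ⁺, N(f, X) equals the (unsigned) number of permutations σ ∈ 𝕊_V(X, X̄) such that f is constant on each cycle of σ. (In particular, all coefficients of W_X in the noncommutative power sum basis are nonnegative integers.) -/
/-- A cycle `c` of a permutation (given as one of its cycle factors, with underlying orbit
`c.support`) is a cycle of the digraph with edge set `E` if `(w, c w) ∈ E` for every
vertex `w` of the cycle. -/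
def IsDigraphCycle {V : Type*} [Fintype V] [DecidableEq V] (E : Set (V × V))
    (c : Equiv.Perm V) : Prop :=
  ∀ w ∈ c.support, (w, c w) ∈ E

/-- `σ ∈ 𝕊_V(X, X̄)`: every cycle of the permutation `σ` is a cycle of `X` or a cycle of
the complement `X̄`.  (Fixed points of `σ` are automatically cycles of `X` or of `X̄`, so
only the nontrivial cycle factors need to be checked.) -/
def MemSVXXbar {V : Type*} [Fintype V] [DecidableEq V] (E : Set (V × V))
    (σ : Equiv.Perm V) : Prop :=
  ∀ c ∈ σ.cycleFactorsFinset, IsDigraphCycle E c ∨ IsDigraphCycle Eᶜ c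

section Aux
open Equiv

def Acyc {Z : Type*} (c : Perm Z) (R : Set Z) : Prop :=
  ∀ A ⊆ R, (∀ a ∈ A, c a ∈ A) → A = ∅

lemma acyc_swap {Z : Type*} [DecidableEq Z] (c c0 : Perm Z) (s i : Z) (hi : i ≠ s)
    (h0 : c0 s = s) (hc : c = swap s i * c0) (R : Set Z) (hs : s ∈ R) :
    Acyc c R ↔ Acyc c0 (R \ {s}) := by
  have hcs : c s = i := by rw [hc]; simp [h0]
  have hcv : ∀ v, c v = swap s i (c0 v) := fun v => by rw [hc]; simp
  have hinj : ∀ v, c v = i → v = s := fun v hv => c.injective (hv.trans hcs.symm)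
  constructor
  · intro h A hA hinv
    have hsA : s ∉ A := fun hh => (hA hh).2 rfl
    by_cases hiA : i ∈ A
    · have : insert s A = ∅ := by
        apply h
        · intro x hx
          rcases hx with rfl | hx
          · exact hs
          · exact (hA hx).1
        · intro a ha
          rcases ha with rfl | ha
          · rw [hcs]; exact Or.inr hiA
          · rw [hcv]
            have h1 := hinv a ha
            by_cases h2 : c0 a = i
            · rw [h2, swap_apply_right]; exact Or.inl rfl
            · rw [swap_apply_of_ne_of_ne (fun h => hsA (by rwa [h] at h1)) h2]; exact Or.inr h1
      exact absurd this (Set.insert_nonempty s A).ne_empty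
    · apply h A (fun x hx => (hA hx).1)
      intro a ha
      have h1 := hinv a ha
      rw [hcv, swap_apply_of_ne_of_ne (fun h => hsA (by rwa [h] at h1)) (fun h => hiA (by rwa [h] at h1))]
      exact h1
  · intro h A hA hinv
    have h0v : ∀ v, c0 v = swap s i (c v) := fun v => by rw [hcv]; simp
    have h1 : A \ {s} = ∅ := by
      apply h
      · exact fun x hx => ⟨hA hx.1, hx.2⟩
      · rintro a ⟨ha, has⟩
        have has : a ≠ s := has
        have h2 := hinv a ha
        rw [h0v]
        by_cases h3 : c a = s
        · rw [h3, swap_apply_left]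
          refine ⟨?_, hi⟩
          have := hinv s (h3 ▸ h2)
          rwa [hcs] at this
        · rw [swap_apply_of_ne_of_ne h3 (fun h => has (hinj a h))]
          exact ⟨h2, h3⟩
    by_contra hne
    obtain ⟨a, ha⟩ := Set.nonempty_iff_ne_empty.mpr hne
    have hsub : ∀ x ∈ A, x = s := by
      intro x hx
      by_contra hxs
      have : x ∈ A \ {s} := ⟨hx, hxs⟩
      rw [h1] at this; exact this
    have := hsub a ha
    subst this
    have h4 := hsub _ (hinv _ ha)
    rw [hcs] at h4
    exact hi h4

def PS {Z : Type*} (T R S : Set Z) (g : Z → Z) : Set (Perm Z) :=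
  {c | (∀ v ∈ T, c v = v) ∧ (∀ v ∈ S, c v = g v) ∧ Acyc c R}

lemma ps_elim {Z : Type*} [DecidableEq Z] (T R S : Set Z) (g : Z → Z) (s : Z)
    (hs : s ∈ S) (hR : s ∈ R) (hT : s ∉ T) (h1 : g s ≠ s) (h2 : g s ∉ T) :
    Nat.card (PS T R S g) =
      Nat.card (PS (insert s T) (R \ {s}) (S \ {s}) (fun v => swap s (g s) (g v))) := by
  apply Nat.card_congr
  refine Equiv.subtypeEquiv (Equiv.mulLeft (swap s (g s))) ?_
  intro c
  simp only [PS, Set.mem_ofPred_eq, Equiv.coe_mulLeft]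
  have key : ∀ v w, (swap s (g s) * c) v = w ↔ c v = swap s (g s) w := by
    intro v w
    rw [Perm.mul_apply]
    constructor
    · rintro rfl; simp
    · intro h; rw [h]; simp
  constructor
  · rintro ⟨a, b, d⟩
    have hcs := b s hs
    have h0 : (swap s (g s) * c) s = s := by rw [key, hcs]; simp
    refine ⟨?_, ?_, ?_⟩
    · rintro v (rfl | hv)
      · exact h0
      · rw [key, a v hv, swap_apply_of_ne_of_ne]
        · rintro rfl; exact hT hv
        · rintro rfl; exact h2 hv
    · rintro v ⟨hv, -⟩
      rw [key, b v hv]; simp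
    · exact (acyc_swap c _ s (g s) h1 h0 (by rw [← mul_assoc]; simp) R hR).1 d
  · rintro ⟨a, b, d⟩
    have h0 := a s (Or.inl rfl)
    refine ⟨?_, ?_, ?_⟩
    · intro v hv
      have := (key _ _).1 (a v (Or.inr hv))
      rwa [swap_apply_of_ne_of_ne] at this
      · rintro rfl; exact hT hv
      · rintro rfl; exact h2 hv
    · intro v hv
      by_cases hvs : v = s
      · subst hvs
        have := (key _ _).1 h0
        simpa using this
      · have := (key _ _).1 (b v ⟨hv, hvs⟩)
        simpa using this
    · exact (acyc_swap c _ s (g s) h1 h0 (by rw [← mul_assoc]; simp) R hR).2 d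

lemma ps_zero {Z : Type*} (T R S : Set Z) (g : Z → Z) (s : Z)
    (hs : s ∈ S) (hR : s ∈ R) (hT : s ∉ T) (h : g s = s ∨ g s ∈ T) :
    Nat.card (PS T R S g) = 0 := by
  have : PS T R S g = ∅ := by
    ext c
    simp only [Set.mem_empty_iff_false, iff_false]
    rintro ⟨a, b, d⟩
    have hb := b s hs
    rcases h with h | h
    · have := d {s} (by simpa using hR) (by intro x hx; rw [hx, hb, h]; rfl)
      simp at this
    · have h1 := a _ h
      have h2 : g s = s := c.injective (h1.trans hb.symm)
      rw [h2] at h; exact hT h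
  rw [this]; simp

lemma base_perm {V : Type*} [Fintype V] (T : Set V) (g : V → V) :
    Nat.card (PS T ∅ ∅ g) = (Tᶜ.ncard).factorial := by
  classical
  have h1 : Nat.card (PS T ∅ ∅ g) = Nat.card (Perm (Tᶜ : Set V)) := by
    apply Nat.card_congr
    refine Equiv.trans ?_ (Equiv.Perm.subtypeEquivSubtypePerm (fun v => v ∈ Tᶜ)).symm
    refine Equiv.subtypeEquivRight ?_
    intro c
    simp only [PS, Set.mem_ofPred_eq, Set.mem_empty_iff_false, false_imp_iff, implies_true,
      true_and, Set.mem_compl_iff, not_not]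
    constructor
    · exact fun h => h.1
    · exact fun h => ⟨h, fun A hA _ => Set.subset_empty_iff.1 hA⟩
  rw [h1, Nat.card_perm]; rfl

lemma base_cyc {V : Type*} [Fintype V] (n : ℕ) : ∀ (T : Set V) (g : Option V → Option V),
    Tᶜ.ncard = n → Nat.card (PS (some '' T) (some '' Tᶜ) ∅ g) = n.factorial := by
  classical
  induction n with
  | zero =>
    intro T g h
    have hT : Tᶜ = ∅ := (Set.ncard_eq_zero (Set.toFinite _)).1 h
    have hT' : T = Set.univ := by simpa using hT
    have : PS (some '' T) (some '' Tᶜ) ∅ g = {1} := by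
      ext c
      simp only [PS, Set.mem_ofPred_eq, Set.mem_empty_iff_false, false_imp_iff, implies_true,
        true_and, Set.mem_singleton_iff, hT']
      constructor
      · rintro ⟨a, -⟩
        have h1 : ∀ v : V, c (some v) = some v := fun v => a _ ⟨v, trivial, rfl⟩
        ext1 x
        cases x with
        | some v => exact h1 v
        | none =>
          cases hn : c none with
          | none => rfl
          | some v => rw [← h1 v] at hn; simpa using c.injective hn
      · rintro rfl
        exact ⟨fun _ _ => rfl, fun A hA _ => by simpa using hA⟩
    rw [this]; simp
  | succ n ih =>
    intro T g h
    obtain ⟨s, hs⟩ : (Tᶜ : Set V).Nonempty := by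
      rw [← Set.ncard_pos]; omega
    have hins : (insert s T)ᶜ.ncard = n := by
      have : (insert s T)ᶜ = Tᶜ \ {s} := by
        ext x; simp [and_comm]
      rw [this, Set.ncard_sdiff_singleton_of_mem hs]; omega
    let P := PS (some '' T) (some '' Tᶜ) ∅ g
    have h1 : Nat.card P = ∑ i : Option V,
        Nat.card (PS (some '' T) (some '' Tᶜ) {some s} (fun _ => i)) := by
      rw [← Nat.card_congr (Equiv.sigmaFiberEquiv (fun c : P => c.1 (some s))), Nat.card_sigma]
      refine Finset.sum_congr rfl fun i _ => ?_
      apply Nat.card_congr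
      refine (Equiv.subtypeSubtypeEquivSubtypeInter (fun c => c ∈ P) (fun c => c (some s) = i)).trans ?_
      refine Equiv.subtypeEquivRight ?_
      intro c
      simp only [P, PS, Set.mem_ofPred_eq, Set.mem_empty_iff_false, false_imp_iff, implies_true,
        true_and, Set.mem_singleton_iff, forall_eq]
      tauto
    have hsT : some s ∉ some '' T := by
      rintro ⟨x, hx, hxs⟩; cases hxs; exact hs hx
    have m3 : some s ∈ some '' Tᶜ := ⟨s, hs, rfl⟩
    have h2 : ∀ i : Option V, Nat.card (PS (some '' T) (some '' Tᶜ) {some s} (fun _ => i)) =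
        if i ∈ insert none (some '' (insert s T)ᶜ) then n.factorial else 0 := by
      intro i
      split_ifs with hi
      · rw [ps_elim _ _ _ _ (some s) (Set.mem_singleton _) m3 hsT]
        · have e1 : insert (some s) (some '' T) = some '' (insert s T) := by
            rw [Set.image_insert_eq]
          have e2 : some '' Tᶜ \ {some s} = some '' (insert s T)ᶜ := by
            ext x; cases x <;> simp [and_comm]
          rw [e1, e2, Set.sdiff_self]
          exact ih _ _ hins
        · rintro rfl
          simp at hi
        · rcases hi with rfl | ⟨x, hx, rfl⟩
          · simp
          · rintro ⟨y, hy, hxy⟩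
            cases hxy
            exact hx (Or.inr hy)
      · apply ps_zero _ _ _ _ (some s) (Set.mem_singleton _) m3 hsT
        cases i with
        | none => simp at hi
        | some x =>
          simp at hi ⊢
          tauto
    change Nat.card P = _
    rw [h1, Finset.sum_congr rfl fun i _ => h2 i, Finset.sum_ite, Finset.sum_const,
      Finset.sum_const_zero, add_zero, smul_eq_mul, Nat.factorial_succ]
    congr 1
    rw [← Set.ncard_coe_finset]
    have : (↑(Finset.filter (fun x => x ∈ insert none (some '' (insert s T)ᶜ)) Finset.univ) :
      Set (Option V)) = insert none (some '' (insert s T)ᶜ) := by ext; simp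
    rw [this, Set.ncard_insert_of_notMem (by simp),
      Set.ncard_image_of_injective _ (Option.some_injective V), hins]

lemma ps_congr {Z : Type*} (T R S : Set Z) (g g' : Z → Z) (h : ∀ v ∈ S, g v = g' v) :
    PS T R S g = PS T R S g' := by
  ext c
  simp only [PS, Set.mem_ofPred_eq]
  constructor
  · rintro ⟨a, b, d⟩; exact ⟨a, fun v hv => (b v hv).trans (h v hv), d⟩
  · rintro ⟨a, b, d⟩; exact ⟨a, fun v hv => (b v hv).trans (h v hv).symm, d⟩

lemma count_eq {V : Type*} [Fintype V] [DecidableEq V] (S : Finset V) :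
    ∀ (T : Set V) (g : V → V), (∀ v ∈ S, v ∉ T) →
    Nat.card (PS (some '' T) (some '' Tᶜ) (some '' (S : Set V)) (Option.map g)) =
      Nat.card (PS T S S g) := by
  induction S using Finset.induction_on with
  | empty =>
    intro T g _
    simp only [Finset.coe_empty, Set.image_empty]
    rw [base_perm, base_cyc _ _ _ rfl]
  | insert s S hsS ih =>
    intro T g hd
    have hs := hd s (by simp)
    have hsT : some s ∉ some '' T := by
      rintro ⟨x, hx, hxs⟩; cases hxs; exact hs hx
    have m3 : some s ∈ some '' Tᶜ := ⟨s, hs, rfl⟩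
    have m1 : some s ∈ some '' ((insert s S : Finset V) : Set V) := ⟨s, by simp, rfl⟩
    have m2 : s ∈ ((insert s S : Finset V) : Set V) := by simp
    by_cases hg : g s = s ∨ g s ∈ T
    · rw [ps_zero _ _ _ _ s m2 m2 hs hg, ps_zero _ _ _ _ (some s) m1 m3 hsT]
      simpa using hg
    · push Not at hg
      rw [ps_elim _ _ _ _ s m2 m2 hs hg.1 hg.2,
        ps_elim _ _ _ _ (some s) m1 m3 hsT (by simpa using hg.1) (by simpa using hg.2)]
      have e1 : insert (some s) (some '' T) = some '' (insert s T) := by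
        rw [Set.image_insert_eq]
      have e2 : some '' Tᶜ \ {some s} = some '' (insert s T)ᶜ := by
        ext x; cases x <;> simp [and_comm]
      have e3 : ((insert s S : Finset V) : Set V) \ {s} = S := by
        ext x; simp; rintro hx rfl; exact hsS hx
      have e4 : some '' ((insert s S : Finset V) : Set V) \ {some s} = some '' (S : Set V) := by
        conv_rhs => rw [← e3]
        ext x; cases x <;> simp <;> tauto
      rw [e1, e2, e3, e4, ← ih]
      · congr 2
        apply ps_congr
        rintro _ ⟨v, hv, rfl⟩
        simp only [Option.map_some]
        exact ((Option.some_injective V).swap_apply _ _ _)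
      · intro v hv
        have := hd v (by simp [hv])
        simp only [Set.mem_insert_iff, not_or]
        exact ⟨fun h => hsS (h ▸ hv), this⟩

lemma inv_back {V : Type*} [Finite V] (τ : Perm V) (A : Set V) (h : ∀ a ∈ A, τ a ∈ A) (x : V)
    (hx : τ x ∈ A) : x ∈ A := by
  have h1 : τ '' A = A := by
    apply Set.eq_of_subset_of_ncard_le
    · rintro _ ⟨a, ha, rfl⟩; exact h a ha
    · rw [Set.ncard_image_of_injective _ τ.injective]
    · exact Set.toFinite _
  rw [← h1] at hx
  obtain ⟨a, ha, hax⟩ := hx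
  exact τ.injective hax ▸ ha

open Classical in
noncomputable def wt {V : Type*} (τ : Perm V) (S : Finset V) : ℤ :=
  if Acyc τ (S : Set V) then (-1) ^ S.card else 0

lemma sum_mixed {V : Type*} (τ : Perm V) (D : Finset V) (v : V) (hv : v ∈ D)
    (hv' : τ v ∉ D) : ∑ S ∈ D.powerset, wt τ S = 0 := by
  classical
  rw [← Finset.insert_erase hv, Finset.sum_powerset_insert (Finset.notMem_erase v D),
    ← Finset.sum_add_distrib]
  apply Finset.sum_eq_zero
  intro S hS
  rw [Finset.mem_powerset] at hS
  have hvS : v ∉ S := fun h => Finset.notMem_erase v D (hS h)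
  have : Acyc τ ((insert v S : Finset V) : Set V) ↔ Acyc τ (S : Set V) := by
    constructor
    · intro h A hA hinv
      exact h A (fun x hx => by simpa using Or.inr (hA hx)) hinv
    · intro h A hA hinv
      apply h A _ hinv
      have hvA : v ∉ A := by
        intro hvA
        have h1 := hA (hinv v hvA)
        simp only [Finset.coe_insert, Set.mem_insert_iff, Finset.mem_coe] at h1
        rcases h1 with h1 | h1
        · rw [h1] at hv'; exact hv' hv
        · exact hv' (Finset.mem_of_mem_erase (hS h1))
      intro x hx
      have h1 := hA hx
      simp only [Finset.coe_insert, Set.mem_insert_iff, Finset.mem_coe] at h1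
      rcases h1 with rfl | h1
      · exact absurd hx hvA
      · exact h1
  unfold wt
  rw [if_congr this rfl rfl, Finset.card_insert_of_notMem hvS]
  split_ifs
  · ring
  · ring

lemma sum_odd {V : Type*} [Fintype V] (τ : Perm V) (D : Finset V) :
    (∀ v ∈ D, τ v ∈ D) → (∀ v ∈ D, Odd (Function.minimalPeriod τ v)) →
    ∑ S ∈ D.powerset, wt τ S = 1 := by
  classical
  induction D using Finset.strongInduction with
  | H D ih =>
  intro hinv hodd
  rcases D.eq_empty_or_nonempty with rfl | ⟨v, hv⟩
  · have : Acyc τ (∅ : Set V) := fun A hA _ => Set.subset_empty_iff.1 hA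
    simp [wt, this]
  · set k := Function.minimalPeriod τ v with hk
    have hkodd : Odd k := hodd v hv
    have hkpos : 0 < k := hkodd.pos
    set γ : Finset V := (Finset.range k).image (fun i => τ^[i] v) with hγ
    have hmem : ∀ i, τ^[i] v ∈ γ := by
      intro i
      rw [hγ, Finset.mem_image]
      exact ⟨i % k, Finset.mem_range.2 (Nat.mod_lt _ hkpos),
        Function.iterate_mod_minimalPeriod_eq⟩
    have hrep : ∀ x ∈ γ, ∃ i < k, τ^[i] v = x := by
      intro x hx
      rw [hγ, Finset.mem_image] at hx
      obtain ⟨i, hi, rfl⟩ := hx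
      exact ⟨i, Finset.mem_range.1 hi, rfl⟩
    have hγinv : ∀ x ∈ γ, τ x ∈ γ := by
      intro x hx
      obtain ⟨i, -, rfl⟩ := hrep x hx
      rw [← Function.iterate_succ_apply' τ i v]; exact hmem _
    have hγcard : γ.card = k := by
      rw [hγ, Finset.card_image_of_injOn, Finset.card_range]
      intro i hi j hj hij
      exact Function.iterate_injOn_Iio_minimalPeriod (by simpa using hi) (by simpa using hj) hij
    have hvγ : v ∈ γ := hmem 0
    have hγD : γ ⊆ D := by
      intro x hx
      obtain ⟨i, -, rfl⟩ := hrep x hx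
      clear hx
      induction i with
      | zero => exact hv
      | succ i ihi => rw [Function.iterate_succ_apply']; exact hinv _ ihi
    have hγmin : ∀ A : Set V, (∀ a ∈ A, τ a ∈ A) → ∀ x ∈ γ, x ∈ A → ∀ y ∈ γ, y ∈ A := by
      intro A hA x hx hxA y hy
      obtain ⟨i, hi, rfl⟩ := hrep x hx
      obtain ⟨j, -, rfl⟩ := hrep y hy
      have hit : ∀ m z, z ∈ A → τ^[m] z ∈ A := by
        intro m z hz
        induction m with
        | zero => exact hz
        | succ m ihm => rw [Function.iterate_succ_apply']; exact hA _ ihm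
      have h1 : τ^[j] v = τ^[j + (k - i)] (τ^[i] v) := by
        rw [← Function.iterate_add_apply, show j + (k - i) + i = j + k by omega,
          Function.iterate_add_apply τ j k, hk, Function.iterate_minimalPeriod]
      rw [h1]; exact hit _ _ hxA
    have hwγ : ∀ S ∈ γ.powerset, wt τ S = (-1) ^ S.card - if S = γ then (-1) ^ S.card else 0 := by
      intro S hS
      rw [Finset.mem_powerset] at hS
      unfold wt
      by_cases h : S = γ
      · have : ¬ Acyc τ (S : Set V) := by
          intro h1
          have := h1 S subset_rfl (by rw [h]; exact hγinv)
          have h2 : v ∈ (S : Set V) := by rw [h]; exact hvγ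
          rw [this] at h2; exact h2
        rw [if_neg this, if_pos h]; ring
      · have : Acyc τ (S : Set V) := by
          intro A hA hAinv
          by_contra hne
          obtain ⟨a, ha⟩ := Set.nonempty_iff_ne_empty.mpr hne
          apply h
          apply Finset.Subset.antisymm hS
          intro y hy
          exact hA (hγmin A hAinv a (hS (hA ha)) ha y hy)
        rw [if_pos this, if_neg h]; ring
    have hsγ : ∑ S ∈ γ.powerset, wt τ S = 1 := by
      rw [Finset.sum_congr rfl hwγ, Finset.sum_sub_distrib,
        Finset.sum_powerset_neg_one_pow_card_of_nonempty ⟨v, hvγ⟩, Finset.sum_ite_eq',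
        if_pos (Finset.mem_powerset_self γ), hγcard, hkodd.neg_one_pow]
      norm_num
    have hback : ∀ x, τ x ∈ γ → x ∈ γ := fun x hx => inv_back τ (γ : Set V) hγinv x hx
    have hs2 : ∑ S ∈ (D \ γ).powerset, wt τ S = 1 := by
      apply ih
      · exact Finset.sdiff_ssubset hγD ⟨v, hvγ⟩
      · intro x hx
        rw [Finset.mem_sdiff] at hx ⊢
        exact ⟨hinv x hx.1, fun h => hx.2 (hback x h)⟩
      · intro x hx
        exact hodd x (Finset.mem_sdiff.1 hx).1
    have hmul : ∀ S1 ∈ γ.powerset, ∀ S2 ∈ (D \ γ).powerset,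
        wt τ (S1 ∪ S2) = wt τ S1 * wt τ S2 := by
      intro S1 h1 S2 h2
      rw [Finset.mem_powerset] at h1 h2
      have hac : Acyc τ ((S1 ∪ S2 : Finset V) : Set V) ↔
          Acyc τ (S1 : Set V) ∧ Acyc τ (S2 : Set V) := by
        constructor
        · intro h
          refine ⟨fun A hA hi => h A (fun x hx => ?_) hi, fun A hA hi => h A (fun x hx => ?_) hi⟩
          · simpa using Or.inl (hA hx)
          · simpa using Or.inr (hA hx)
        · rintro ⟨ha, hb⟩ A hA hi
          have e1 : A ∩ γ = ∅ := by
            apply ha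
            · rintro x ⟨hx, hxγ⟩
              have := hA hx
              simp only [Finset.coe_union, Set.mem_union, Finset.mem_coe] at this
              rcases this with h | h
              · exact h
              · exact absurd hxγ (Finset.mem_sdiff.1 (h2 h)).2
            · rintro a ⟨ha1, ha2⟩
              exact ⟨hi a ha1, hγinv a ha2⟩
          have e2 : A \ γ = ∅ := by
            apply hb
            · rintro x ⟨hx, hxγ⟩
              have := hA hx
              simp only [Finset.coe_union, Set.mem_union, Finset.mem_coe] at this
              rcases this with h | h
              · exact absurd (h1 h) hxγ
              · exact h
            · rintro a ⟨ha1, ha2⟩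
              exact ⟨hi a ha1, fun h => ha2 (hback a h)⟩
          rw [← Set.inter_union_sdiff A γ, e1, e2, Set.union_empty]
      have hdis : Disjoint S1 S2 :=
        Finset.disjoint_of_subset_left h1 (Finset.disjoint_of_subset_right h2
          Finset.disjoint_sdiff)
      unfold wt
      rw [if_congr hac rfl rfl, Finset.card_union_of_disjoint hdis, pow_add]
      by_cases a1 : Acyc τ (S1 : Set V) <;> by_cases a2 : Acyc τ (S2 : Set V) <;> simp [a1, a2]
    have hprod : ∑ S ∈ D.powerset, wt τ S =
        ∑ p ∈ γ.powerset ×ˢ (D \ γ).powerset, wt τ (p.1 ∪ p.2) := by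
      symm
      refine Finset.sum_nbij' (fun p => p.1 ∪ p.2) (fun S => (S ∩ γ, S \ γ)) ?_ ?_ ?_ ?_ ?_
      · rintro ⟨S1, S2⟩ h
        simp only [Finset.mem_product, Finset.mem_powerset] at h ⊢
        exact Finset.union_subset (h.1.trans hγD) (h.2.trans Finset.sdiff_subset)
      · intro S h
        simp only [Finset.mem_product, Finset.mem_powerset] at h ⊢
        exact ⟨Finset.inter_subset_right, Finset.sdiff_subset_sdiff h subset_rfl⟩
      · rintro ⟨S1, S2⟩ h
        simp only [Finset.mem_product, Finset.mem_powerset] at h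
        have g1 : ∀ x ∈ S1, x ∈ γ := fun x hx => h.1 hx
        have g2 : ∀ x ∈ S2, x ∉ γ := fun x hx => (Finset.mem_sdiff.1 (h.2 hx)).2
        ext x
        · simp only [Finset.mem_inter, Finset.mem_union]
          have := g1 x; have := g2 x; tauto
        · simp only [Finset.mem_sdiff, Finset.mem_union]
          have := g1 x; have := g2 x; tauto
      · intro S h
        ext x
        simp only [Finset.mem_union, Finset.mem_inter, Finset.mem_sdiff]
        tauto
      · intro p _; rfl
    rw [hprod, Finset.sum_product]
    rw [Finset.sum_congr rfl fun S1 h1 => Finset.sum_congr rfl fun S2 h2 => hmul S1 h1 S2 h2,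
      ← Finset.sum_mul_sum, hsγ, hs2, one_mul]

lemma prod_expand {V : Type*} [Fintype V] [DecidableEq V] (S : Finset V) (p : V → V → Prop)
    [∀ v u, Decidable (p v u)] (x : V → V → ℤ)
    [∀ g : S → V, Decidable (∀ v : S, p v (g v))] :
    ∏ v ∈ S, ∑ u, (if p v u then x v u else 0) =
      ∑ g : S → V, if (∀ v : S, p v (g v)) then ∏ v : S, x v (g v) else 0 := by
  classical
  rw [← Finset.prod_coe_sort, Finset.prod_univ_sum, Fintype.piFinset_univ]
  refine Finset.sum_congr rfl fun g _ => ?_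
  split_ifs with h
  · exact Finset.prod_congr rfl fun v _ => if_pos (h v)
  · push Not at h
    obtain ⟨v, hv⟩ := h
    exact Finset.prod_eq_zero (Finset.mem_univ v) (if_neg hv)

open Classical in
lemma sum_transfer {V : Type*} [Fintype V] (S : Finset V) (x : V → V → ℤ) :
    ∑ c : Perm (Option V), (if Acyc c (Set.range some) then
      ∏ v ∈ S, ∑ u, (if c (some v) = some u then x v u else 0) else 0) =
    ∑ τ : Perm V, (if Acyc τ (S : Set V) then ∏ v ∈ S, x v (τ v) else 0) := by
  have hR : ∀ τ : Perm V, ∏ v ∈ S, x v (τ v) =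
      ∑ g : S → V, if (∀ v : S, τ v = g v) then ∏ v : S, x v (g v) else 0 := by
    intro τ
    rw [← prod_expand S (fun v u => τ v = u) x]
    refine Finset.prod_congr rfl fun v _ => ?_
    simp
  have hL : ∀ c : Perm (Option V), ∏ v ∈ S, ∑ u, (if c (some v) = some u then x v u else 0) =
      ∑ g : S → V, if (∀ v : S, c (some v) = some (g v)) then ∏ v : S, x v (g v) else 0 :=
    fun c => prod_expand S (fun v u => c (some v) = some u) x
  have push : ∀ {α : Type _} [Fintype α] (Q : α → Prop) (P : α → (S → V) → Prop)
      [DecidablePred Q] [∀ c g, Decidable (P c g)],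
      ∑ c : α, (if Q c then ∑ g : S → V, (if P c g then ∏ v : S, x v (g v) else 0) else 0) =
      ∑ g : S → V, (Nat.card {c // Q c ∧ P c g} : ℤ) * ∏ v : S, x v (g v) := by
    intro α _ Q P _ _
    have : ∀ c : α, (if Q c then ∑ g : S → V, (if P c g then ∏ v : S, x v (g v) else 0) else 0)
        = ∑ g : S → V, if Q c ∧ P c g then ∏ v : S, x v (g v) else 0 := by
      intro c
      by_cases h : Q c <;> simp [h]
    rw [Finset.sum_congr rfl fun c _ => this c, Finset.sum_comm]
    refine Finset.sum_congr rfl fun g _ => ?_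
    rw [← Finset.sum_filter, Finset.sum_const, nsmul_eq_mul, Nat.card_eq_fintype_card,
      Fintype.card_subtype]
  simp only [hR, hL]
  rw [push (fun c : Perm (Option V) => Acyc c (Set.range some))
    (fun c g => ∀ v : S, c (some v) = some (g v)),
    push (fun τ : Perm V => Acyc τ (S : Set V)) (fun τ g => ∀ v : S, τ v = g v)]
  refine Finset.sum_congr rfl fun g _ => ?_
  congr 2
  let g' : V → V := fun v => if h : v ∈ S then g ⟨v, h⟩ else v
  have hg' : ∀ v : S, g' v = g v := fun v => by simp [g']
  have key := count_eq S ∅ g' (by simp)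
  refine Eq.trans ?_ (key.trans ?_)
  · apply Nat.card_congr
    refine Equiv.subtypeEquivRight fun c => ?_
    simp only [PS, Set.mem_ofPred_eq, Set.image_empty, Set.mem_empty_iff_false, false_imp_iff,
      implies_true, true_and, Set.compl_empty, Set.image_univ]
    rw [and_comm]
    refine and_congr ?_ Iff.rfl
    constructor
    · rintro h _ ⟨v, hv, rfl⟩
      rw [h ⟨v, hv⟩, Option.map_some, ← hg']
    · intro h v
      rw [h _ ⟨v, v.2, rfl⟩, Option.map_some, ← hg']
  · apply Nat.card_congr
    refine Equiv.subtypeEquivRight fun c => ?_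
    simp only [PS, Set.mem_ofPred_eq, Set.mem_empty_iff_false, false_imp_iff,
      implies_true, true_and]
    rw [and_comm]
    refine and_congr Iff.rfl ?_
    constructor
    · intro h v
      rw [h v v.2, hg']
    · intro h v hv
      rw [h ⟨v, hv⟩, ← hg']

/-- the single cycle through `none` attached to a listing -/
def toCyc {V : Type*} {n : ℕ} (σ : Fin n ≃ V) : Perm (Option V) :=
  ((finSuccEquivLast (n := n)).trans (Equiv.optionCongr σ)).permCongr (finRotate (n + 1))

lemma toCyc_apply {V : Type*} {n : ℕ} (σ : Fin n ≃ V) (j : Fin (n + 1)) :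
    toCyc σ (Equiv.optionCongr σ (finSuccEquivLast j)) =
      Equiv.optionCongr σ (finSuccEquivLast (finRotate (n + 1) j)) := by
  unfold toCyc
  rw [Equiv.permCongr_apply]
  simp only [Equiv.symm_trans_apply, Equiv.symm_apply_apply, Equiv.trans_apply]

lemma toCyc_none {V : Type*} {n : ℕ} (σ : Fin n ≃ V) (h : 0 < n) :
    toCyc σ none = some (σ ⟨0, h⟩) := by
  obtain ⟨m, rfl⟩ : ∃ m, n = m + 1 := ⟨n - 1, by omega⟩
  have : finRotate (m + 1 + 1) (Fin.last _) = Fin.castSucc ⟨0, h⟩ := by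
    rw [finRotate_last]; rfl
  have h2 := toCyc_apply σ (Fin.last _)
  rw [this, finSuccEquivLast_castSucc] at h2
  simpa using h2

lemma toCyc_lt {V : Type*} {n : ℕ} (σ : Fin n ≃ V) (i : Fin n) (h : (i : ℕ) + 1 < n) :
    toCyc σ (some (σ i)) = some (σ ⟨i + 1, h⟩) := by
  have : finRotate (n + 1) (Fin.castSucc i) = Fin.castSucc ⟨i + 1, h⟩ := by
    rw [finRotate_apply]
    ext
    rw [Fin.val_add_one_of_lt (Fin.castSucc_lt_last i)]
    rfl
  have h2 := toCyc_apply σ (Fin.castSucc i)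
  rw [this, finSuccEquivLast_castSucc, finSuccEquivLast_castSucc] at h2
  simpa using h2

lemma toCyc_last {V : Type*} {n : ℕ} (σ : Fin n ≃ V) (i : Fin n) (h : (i : ℕ) + 1 = n) :
    toCyc σ (some (σ i)) = none := by
  have : finRotate (n + 1) (Fin.castSucc i) = Fin.last n := by
    rw [finRotate_apply]
    ext
    rw [Fin.val_add_one_of_lt (Fin.castSucc_lt_last i)]
    simpa using h
  have h2 := toCyc_apply σ (Fin.castSucc i)
  rw [this] at h2
  simpa using h2

lemma toCyc_acyc {V : Type*} {n : ℕ} (σ : Fin n ≃ V) : Acyc (toCyc σ) (Set.range some) := by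
  intro A hA hinv
  by_contra hne
  obtain ⟨a, ha⟩ := Set.nonempty_iff_ne_empty.mpr hne
  have hnone : none ∉ A := fun h => by simpa using hA h
  have : ∀ m : ℕ, ∀ i : Fin n, n - i = m → some (σ i) ∉ A := by
    intro m
    induction m with
    | zero => intro i hi; omega
    | succ m ih =>
      intro i hi hmem
      have h1 := hinv _ hmem
      by_cases h : (i : ℕ) + 1 < n
      · rw [toCyc_lt σ i h] at h1
        exact ih ⟨i + 1, h⟩ (by simp; omega) h1
      · rw [toCyc_last σ i (by omega)] at h1
        exact hnone h1
  obtain ⟨v, rfl⟩ := hA ha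
  apply this _ (σ.symm v) rfl
  simpa using ha

lemma toCyc_inj {V : Type*} {n : ℕ} : Function.Injective (toCyc (V := V) (n := n)) := by
  intro σ σ' h
  have : ∀ m : ℕ, ∀ hm : m < n, σ ⟨m, hm⟩ = σ' ⟨m, hm⟩ := by
    intro m
    induction m with
    | zero =>
      intro hm
      have h1 := toCyc_none σ hm
      rw [h, toCyc_none σ' hm] at h1
      exact (Option.some_injective V h1).symm
    | succ m ih =>
      intro hm
      have h1 := toCyc_lt σ ⟨m, by omega⟩ hm
      rw [h, ih, toCyc_lt σ' ⟨m, by omega⟩ hm] at h1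
      exact (Option.some_injective V h1).symm
  ext i
  exact this i i.2

lemma card_listing {V : Type*} [Fintype V] (r : V → V → Prop) :
    Nat.card {σ : Fin (Fintype.card V) ≃ V // ∀ i : Fin (Fintype.card V),
      ∀ h : (i : ℕ) + 1 < Fintype.card V, ¬ r (σ i) (σ ⟨i + 1, h⟩)} =
    Nat.card {c : Perm (Option V) // Acyc c (Set.range some) ∧
      ∀ v u, c (some v) = some u → ¬ r v u} := by
  classical
  let F : (Fin (Fintype.card V) ≃ V) → {c : Perm (Option V) // Acyc c (Set.range some)} :=
    fun σ => ⟨toCyc σ, toCyc_acyc σ⟩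
  have hF : Function.Bijective F := by
    rw [Nat.bijective_iff_injective_and_card]
    refine ⟨fun a b hab => toCyc_inj (congrArg Subtype.val hab), ?_⟩
    rw [Nat.card_eq_fintype_card, Fintype.card_equiv (Fintype.equivFin V).symm, Fintype.card_fin]
    have h := base_cyc (V := V) _ ∅ id rfl
    have e : {c : Perm (Option V) // Acyc c (Set.range some)} ≃
        PS (some '' (∅ : Set V)) (some '' (∅ : Set V)ᶜ) ∅ id := by
      refine Equiv.subtypeEquivRight fun c => ?_
      simp [PS]
    rw [Nat.card_congr e, h]
    simp [Set.ncard_univ]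
  apply Nat.card_congr
  refine Equiv.trans ?_ (Equiv.subtypeSubtypeEquivSubtypeInter _ _)
  refine Equiv.subtypeEquiv (Equiv.ofBijective F hF) ?_
  intro σ
  simp only [Equiv.ofBijective_apply, F]
  constructor
  · intro h v u hvu
    obtain ⟨i, rfl⟩ := σ.surjective v
    by_cases hi : (i : ℕ) + 1 < Fintype.card V
    · rw [toCyc_lt σ i hi] at hvu
      rw [← Option.some_injective V hvu]
      exact h i hi
    · rw [toCyc_last σ i (by omega)] at hvu
      cases hvu
  · intro h i hi
    exact h _ _ (toCyc_lt σ i hi)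

theorem main_aux {V : Type*} [Fintype V] (r : V → V → Prop)
    (hodd : ∀ (τ : Perm V) (v : V), (∀ u, r u (τ u) → r (τ u) (τ (τ u))) → r v (τ v) →
      Odd (Function.minimalPeriod τ v)) :
    Nat.card {σ : Fin (Fintype.card V) ≃ V // ∀ i : Fin (Fintype.card V),
      ∀ h : (i : ℕ) + 1 < Fintype.card V, ¬ r (σ i) (σ ⟨i + 1, h⟩)} =
    Nat.card {τ : Perm V // ∀ u, r u (τ u) → r (τ u) (τ (τ u))} := by
  classical
  rw [card_listing]
  let x : V → V → ℤ := fun v u => if r v u then -1 else 0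
  have h1 : ((Nat.card {c : Perm (Option V) // Acyc c (Set.range some) ∧
      ∀ v u, c (some v) = some u → ¬ r v u} : ℕ) : ℤ) =
      ∑ c : Perm (Option V), (if Acyc c (Set.range some) then
        ∏ v, (1 + ∑ u, (if c (some v) = some u then x v u else 0)) else 0) := by
    rw [Nat.card_eq_fintype_card, Fintype.card_subtype, Finset.card_filter]
    push_cast
    refine Finset.sum_congr rfl fun c _ => ?_
    by_cases ha : Acyc c (Set.range some)
    · simp only [ha, true_and, if_true]
      split_ifs with hg
      · symm
        apply Finset.prod_eq_one
        intro v _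
        rw [Finset.sum_eq_zero, add_zero]
        intro u _
        split_ifs with hu
        · exact if_neg (hg v u hu)
        · rfl
      · push Not at hg
        obtain ⟨v, u, hvu, hr⟩ := hg
        symm
        apply Finset.prod_eq_zero (Finset.mem_univ v)
        simp [hvu, x, hr]
    · simp [ha]
  have h2 : ((Nat.card {τ : Perm V // ∀ u, r u (τ u) → r (τ u) (τ (τ u))} : ℕ) : ℤ) =
      ∑ τ : Perm V, ∑ S : Finset V,
        (if Acyc τ (S : Set V) then ∏ v ∈ S, x v (τ v) else 0) := by
    rw [Nat.card_eq_fintype_card, Fintype.card_subtype, Finset.card_filter]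
    push_cast
    refine Finset.sum_congr rfl fun τ _ => ?_
    let D : Finset V := Finset.univ.filter (fun v => r v (τ v))
    have hD : ∀ v, v ∈ D ↔ r v (τ v) := fun v => by simp [D]
    have h3 : ∑ S : Finset V, (if Acyc τ (S : Set V) then ∏ v ∈ S, x v (τ v) else 0) =
        ∑ S ∈ D.powerset, wt τ S := by
      symm
      rw [← Finset.sum_subset (Finset.subset_univ D.powerset)]
      · refine Finset.sum_congr rfl fun S hS => ?_
        rw [Finset.mem_powerset] at hS
        unfold wt
        congr 1
        rw [Finset.prod_congr rfl fun v hv => if_pos ((hD v).1 (hS hv)), Finset.prod_const]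
      · intro S _ hS
        rw [Finset.mem_powerset, Finset.not_subset] at hS
        obtain ⟨v, hv, hvD⟩ := hS
        rw [Finset.prod_eq_zero hv (if_neg (fun h => hvD ((hD v).2 h)))]
        simp
    rw [h3]
    split_ifs with h
    · symm
      apply sum_odd
      · intro v hv
        rw [hD] at hv ⊢
        exact h v hv
      · intro v hv
        exact hodd τ v h ((hD v).1 hv)
    · push Not at h
      obtain ⟨v, hv, hv'⟩ := h
      exact (sum_mixed τ D v ((hD v).2 hv) (fun h => hv' ((hD _).1 h))).symm
  have h4 : ∀ c : Perm (Option V), (if Acyc c (Set.range some) then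
        ∏ v, (1 + ∑ u, (if c (some v) = some u then x v u else 0)) else 0) =
      ∑ S : Finset V, (if Acyc c (Set.range some) then
        ∏ v ∈ S, (∑ u, (if c (some v) = some u then x v u else 0)) else 0) := by
    intro c
    split_ifs
    · rw [Finset.prod_one_add, Finset.powerset_univ]
    · simp
  rw [← Nat.cast_inj (R := ℤ), h1, h2, Finset.sum_congr rfl fun c _ => h4 c, Finset.sum_comm,
    Finset.sum_congr rfl fun S _ => sum_transfer S x, Finset.sum_comm]

lemma iter_inv {V : Type*} (τ : Perm V) (A : Set V) (h : ∀ a ∈ A, τ a ∈ A) (a : V) (ha : a ∈ A)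
    (m : ℕ) : τ^[m] a ∈ A := by
  induction m with
  | zero => exact ha
  | succ m ih => rw [Function.iterate_succ_apply']; exact h _ ih

lemma iter_order {V : Type*} [Finite V] (τ : Perm V) (a : V) : τ^[orderOf τ] a = a := by
  rw [Equiv.Perm.iterate_eq_pow, pow_orderOf_eq_one]; rfl

lemma mono_const {V β : Type*} [Finite V] [PartialOrder β] (τ : Perm V) (A : Set V)
    (h : ∀ a ∈ A, τ a ∈ A) (f : V → β) (hf : ∀ a ∈ A, f (τ a) ≤ f a) (a : V) (ha : a ∈ A) :
    f (τ a) = f a := by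
  apply le_antisymm (hf a ha)
  have h1 : ∀ m b, b ∈ A → f (τ^[m] b) ≤ f b := by
    intro m b hb
    induction m with
    | zero => exact le_rfl
    | succ m ih =>
      rw [Function.iterate_succ_apply']
      exact (hf _ (iter_inv τ A h b hb m)).trans ih
  have h2 := h1 (orderOf τ - 1) (τ a) (h a ha)
  rw [← Function.iterate_succ_apply τ, Nat.succ_eq_add_one,
    Nat.sub_add_cancel (orderOf_pos τ), iter_order] at h2
  exact h2

lemma mem_iff {V : Type*} [Fintype V] [DecidableEq V] (E : Set (V × V)) (τ : Perm V) :
    MemSVXXbar E τ ↔ ∀ u, (u, τ u) ∈ E → (τ u, τ (τ u)) ∈ E := by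
  constructor
  · intro h u hu
    by_cases hfix : τ u = u
    · rw [hfix, hfix]; rwa [hfix] at hu
    · have hsupp : u ∈ τ.support := Perm.mem_support.2 hfix
      have hc : τ.cycleOf u ∈ τ.cycleFactorsFinset :=
        Perm.cycleOf_mem_cycleFactorsFinset_iff.2 hsupp
      have m1 : u ∈ (τ.cycleOf u).support := by
        rw [Perm.mem_support_cycleOf_iff]; exact ⟨Perm.SameCycle.refl _ _, hsupp⟩
      have m2 : τ u ∈ (τ.cycleOf u).support := by
        have := Perm.apply_mem_support.2 m1
        rwa [Perm.cycleOf_apply_self] at this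
      have a1 : τ.cycleOf u u = τ u := Perm.cycleOf_apply_self _ _
      have a2 : τ.cycleOf u (τ u) = τ (τ u) :=
        ((Perm.mem_cycleFactorsFinset_iff.1 hc).2 _ m2)
      rcases h _ hc with h | h
      · have := h _ m2
        rwa [a2] at this
      · have := h _ m1
        rw [a1] at this
        exact absurd hu this
  · intro h c hc
    obtain ⟨hcyc, hcτ⟩ := Perm.mem_cycleFactorsFinset_iff.1 hc
    obtain ⟨w, hw, hsame⟩ := hcyc
    have hw' : w ∈ c.support := Perm.mem_support.2 hw
    have hreach : ∀ A : Set V, (∀ a ∈ A, τ a ∈ A) → w ∈ A → ∀ y ∈ c.support, y ∈ A := by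
      intro A hA hwA y hy
      obtain ⟨m, hm⟩ := (hsame (Perm.mem_support.1 hy)).exists_nat_pow_eq
      have : ∀ m : ℕ, (c ^ m) w ∈ A := by
        intro m
        induction m with
        | zero => exact hwA
        | succ m ih =>
          rw [pow_succ', Perm.mul_apply, hcτ _ (Perm.pow_apply_mem_support.2 hw')]
          exact hA _ ih
      rw [← hm]; exact this m
    by_cases hwE : (w, τ w) ∈ E
    · left
      intro y hy
      rw [hcτ y hy]
      exact hreach {v | (v, τ v) ∈ E} h hwE y hy
    · right
      intro y hy
      rw [hcτ y hy]
      refine hreach {v | (v, τ v) ∉ E} ?_ hwE y hy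
      intro a ha hb
      exact ha (inv_back τ {v | (v, τ v) ∈ E} h a hb)

/-- the auxiliary digraph that incorporates the coloring -/
def auxRel {V : Type*} (E : Set (V × V)) (f : V → ℕ+) (u v : V) : Prop :=
  f v < f u ∨ (f u = f v ∧ (u, v) ∈ E)

lemma aux_const {V : Type*} [Finite V] (E : Set (V × V)) (f : V → ℕ+) (τ : Perm V)
    (h : ∀ u, auxRel E f u (τ u) → auxRel E f (τ u) (τ (τ u))) (v : V) : f (τ v) = f v := by
  by_cases hv : auxRel E f v (τ v)
  · refine mono_const τ {u | auxRel E f u (τ u)} h f ?_ v hv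
    rintro a (ha | ha)
    · exact ha.le
    · exact ha.1.ge
  · refine mono_const (β := ℕ+ᵒᵈ) τ {u | ¬ auxRel E f u (τ u)} ?_ f ?_ v hv
    · intro a ha hb
      exact ha (inv_back τ {v | auxRel E f v (τ v)} h a hb)
    · intro a ha
      have : ¬ f (τ a) < f a := fun hh => ha (Or.inl hh)
      exact not_lt.1 this

lemma aux_mem_iff {V : Type*} [Fintype V] [DecidableEq V] (E : Set (V × V)) (f : V → ℕ+)
    (τ : Perm V) : (MemSVXXbar E τ ∧ ∀ w : V, f (τ w) = f w) ↔
      ∀ u, auxRel E f u (τ u) → auxRel E f (τ u) (τ (τ u)) := by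
  rw [mem_iff]
  have key : (∀ w : V, f (τ w) = f w) → ∀ u, auxRel E f u (τ u) ↔ (u, τ u) ∈ E := by
    intro hf u
    simp [auxRel, hf u]
  constructor
  · rintro ⟨h, hf⟩ u hu
    rw [key hf] at hu ⊢
    exact h u hu
  · intro h
    have hf := aux_const E f τ h
    refine ⟨fun u hu => ?_, hf⟩
    rw [← key hf] at hu ⊢
    exact h u hu

lemma friendly_iff {V : Type*} [Fintype V] (E : Set (V × V)) (f : V → ℕ+)
    (σ : Fin (Fintype.card V) ≃ V) : Friendly E f σ ↔ ∀ i : Fin (Fintype.card V),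
      ∀ h : (i : ℕ) + 1 < Fintype.card V, ¬ auxRel E f (σ i) (σ ⟨i + 1, h⟩) := by
  constructor
  · rintro ⟨h1, h2⟩ i h (h3 | ⟨h3, h4⟩)
    · have : i ≤ ⟨i + 1, h⟩ := by rw [Fin.le_def]; simp
      exact absurd h3 (not_lt.2 (h1 this))
    · exact absurd (h2 i h h4) (by rw [h3]; exact lt_irrefl _)
  · intro hh
    have hstep : ∀ i : Fin (Fintype.card V), ∀ h : (i : ℕ) + 1 < Fintype.card V,
        f (σ i) ≤ f (σ ⟨i + 1, h⟩) := fun i h => not_lt.1 fun h3 => hh i h (Or.inl h3)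
    constructor
    · intro i j hij
      have : ∀ m : ℕ, (i : ℕ) ≤ m → ∀ hm : m < Fintype.card V, f (σ i) ≤ f (σ ⟨m, hm⟩) := by
        intro m him
        induction m, him using Nat.le_induction with
        | base => intro hm; exact le_rfl
        | succ m him ih =>
          intro hm
          exact (ih (by omega)).trans (hstep ⟨m, by omega⟩ hm)
      exact this j hij j.2
    · intro i h hE
      exact lt_of_le_of_ne (hstep i h) fun he => hh i h (Or.inr ⟨he, hE⟩)

end Aux

/-- If every directed cycle of the digraph `X = (V, E)` has odd length, then for every
coloring `f`, `N(f, X)` equals the (unsigned) number of permutations `σ ∈ 𝕊_V(X, X̄)`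
such that `f` is constant on each cycle of `σ`. -/
theorem redeiBergeCount_of_odd_cycles {V : Type*} [Fintype V] [DecidableEq V]
    (E : Set (V × V))
    (hodd : ∀ k : ℕ, ∀ hk : 0 < k, ∀ w : Fin k → V, Function.Injective w →
      (∀ i : Fin k, (w i, w ⟨((i : ℕ) + 1) % k, Nat.mod_lt _ hk⟩) ∈ E) → Odd k)
    (f : V → ℕ+) :
    redeiBergeCount E f =
      Nat.card {σ : Equiv.Perm V // MemSVXXbar E σ ∧ ∀ w : V, f (σ w) = f w} := by

  unfold redeiBergeCount
  rw [Nat.card_congr (Equiv.subtypeEquivRight fun σ => friendly_iff E f σ),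
    Nat.card_congr (Equiv.subtypeEquivRight fun σ => aux_mem_iff E f σ)]
  apply main_aux
  intro τ v h hv
  have hf := aux_const E f τ h
  have hk : 0 < Function.minimalPeriod τ v := by
    apply Function.IsPeriodicPt.minimalPeriod_pos (orderOf_pos τ)
    exact iter_order τ v
  refine hodd _ hk (fun i => τ^[(i : ℕ)] v) ?_ ?_
  · intro i j hij
    exact Fin.ext (Function.iterate_injOn_Iio_minimalPeriod i.2 j.2 hij)
  · intro i
    have h1 : τ^[((i : ℕ) + 1) % Function.minimalPeriod τ v] v = τ^[(i : ℕ) + 1] v :=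
      Function.iterate_mod_minimalPeriod_eq
    have h2 : auxRel E f (τ^[(i : ℕ)] v) (τ (τ^[(i : ℕ)] v)) :=
      iter_inv τ {u | auxRel E f u (τ u)} h v hv i
    simp only [h1, Function.iterate_succ_apply']
    rcases h2 with h2 | h2
    · rw [hf] at h2; exact absurd h2 (lt_irrefl _)
    · exact h2.2
end

section
/- Elementary basis expansion: let X = (V, E) be a digraph. For each set partition π of V define the rational number c_π = Σ_{σ ∈ 𝕊_V(X, X̄), π ≤ Type(σ)} (−1)^{φ(σ)} · μ(π, Type(σ)) / μ(0̂, Type(σ)), where μ is the Möbius function of the lattice of set partitions of V ordered by refinement, Type(σ) is the partition of V into the cycles of σ, and 0̂ is the partition into singletons. Then for every coloring f : V → ℤ⁺: (N(f, X) viewed in ℚ) = Σ_π c_π · [f is injective on each block of π], the sum over all set partitions π of V, where [·] is 1 if the condition holds and 0 otherwise. (Equivalently, [e_π]W_X = c_π.) -/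
open Classical in
/-- `φ(σ) = Σ_γ (ℓ(γ) − 1)`, summed over all cycles `γ` of `σ` that are cycles of `X`.
(Fixed points contribute `ℓ − 1 = 0`, so it suffices to sum over nontrivial cycle factors.) -/
noncomputable def phi {V : Type*} [Fintype V] [DecidableEq V] (E : Set (V × V))
    (σ : Equiv.Perm V) : ℕ :=
  ∑ c ∈ σ.cycleFactorsFinset.filter (fun c => IsDigraphCycle E c), (c.support.card - 1)

/-- `Type(σ)`: the set partition of `V` into the cycles of `σ`, viewed as an equivalence
relation (`Setoid`); two vertices are related iff they lie on the same cycle of `σ`.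
Set partitions of `V` are identified with elements of `Setoid V`, which Mathlib orders by
refinement (`π ≤ ρ` iff every block of `π` is contained in a block of `ρ`); the bottom
element `⊥` is the partition of `V` into singletons. -/
def typeSetoid {V : Type*} (σ : Equiv.Perm V) : Setoid V :=
  ⟨σ.SameCycle, Equiv.Perm.SameCycle.refl σ, fun h => h.symm, fun h h' => h.trans h'⟩

set_option linter.unusedSectionVars false

namespace RB
open Finset
variable {V : Type*} [DecidableEq V]

/-- consecutive pairs of a list -/
def arcs : List V → List (V × V)
  | [] => []
  | [_] => []
  | a :: b :: l => (a, b) :: arcs (b :: l)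

noncomputable def Ls (W : Finset V) : Finset (List V) := W.toList.permutations.toFinset

lemma arcs_append (a : List V) (u : V) (b : List V) :
    arcs (a ++ u :: b) = arcs (a ++ [u]) ++ arcs (u :: b) := by
  induction a with
  | nil => simp [arcs]
  | cons x a ih => cases a with
    | nil => simp [arcs]
    | cons y a => simpa [arcs] using ih

lemma mem_Ls {W : Finset V} {l : List V} : l ∈ Ls W ↔ l.Nodup ∧ l.toFinset = W := by
  unfold Ls
  rw [List.mem_toFinset, List.mem_permutations]
  constructor
  · intro h
    exact ⟨h.nodup_iff.2 W.nodup_toList, by rw [List.toFinset_eq_of_perm _ _ h, toList_toFinset]⟩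
  · rintro ⟨h, h'⟩
    exact List.perm_of_nodup_nodup_toFinset_eq h W.nodup_toList (by rw [h', toList_toFinset])

lemma card_Ls (W : Finset V) : (Ls W).card = W.card.factorial := by
  unfold Ls
  rw [List.toFinset_card_of_nodup (List.nodup_permutations _ W.nodup_toList),
    List.length_permutations, length_toList]

lemma arcs_fst_mem {l : List V} {x y : V} (h : (x, y) ∈ arcs l) : x ∈ l ∧ y ∈ l := by
  induction l with
  | nil => simp [arcs] at h
  | cons a l ih => cases l with
    | nil => simp [arcs] at h
    | cons b l =>
      simp only [arcs, List.mem_cons, Prod.mk.injEq] at h ih ⊢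
      grind

lemma mem_arcs_iff {l : List V} {x y : V} :
    (x, y) ∈ arcs l ↔ ∃ i, ∃ h : i + 1 < l.length, l[i] = x ∧ l[i+1] = y := by
  induction l with
  | nil => simp [arcs]
  | cons a l ih => cases l with
    | nil => simp [arcs]
    | cons b l =>
      simp only [arcs, List.mem_cons, Prod.mk.injEq, ih]
      constructor
      · rintro (⟨rfl, rfl⟩ | ⟨i, h, h1, h2⟩)
        · exact ⟨0, by simp, by simp⟩
        · exact ⟨i + 1, by simpa using h, by simpa using ⟨h1, h2⟩⟩
      · rintro ⟨i, h, h1, h2⟩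
        cases i with
        | zero => left; simp_all
        | succ i => right; exact ⟨i, by simpa using h, by simpa using h1, by simpa using h2⟩

/-- deleting / inserting `v` right after `u` -/
lemma arcs_insert {a b : List V} {u v x y : V} (hxu : x ≠ u) (hxv : x ≠ v)  :
    (x, y) ∈ arcs (a ++ u :: v :: b) ↔ (x, y) ∈ arcs (a ++ u :: b) := by
  rw [arcs_append, arcs_append a u b]
  cases b <;> simp [arcs, hxu, hxv]

lemma split_of_arc {l : List V} {u v : V} (h : (u, v) ∈ arcs l) :
    ∃ a b, l = a ++ u :: v :: b := by
  obtain ⟨i, hi, rfl, rfl⟩ := mem_arcs_iff.1 h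
  refine ⟨l.take i, l.drop (i+2), ?_⟩
  simp

lemma arcs_mid (a b : List V) (u v : V) : (u, v) ∈ arcs (a ++ u :: v :: b) := by
  rw [arcs_append]; simp [arcs]

lemma count_listings (n : ℕ) : ∀ (W : Finset V) (F : Finset (V × V)) (r : V → ℕ),
    F.card = n →
    (∀ p ∈ F, p.1 ∈ W ∧ p.2 ∈ W ∧ r p.2 < r p.1) →
    (∀ p ∈ F, ∀ q ∈ F, p.1 = q.1 → p = q) →
    (∀ p ∈ F, ∀ q ∈ F, p.2 = q.2 → p = q) →
    ((Ls W).filter (fun l => ∀ p ∈ F, p ∈ arcs l)).card = (W.card - F.card).factorial := by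
  induction n with
  | zero =>
    intro W F r hF _ _ _
    rw [Finset.card_eq_zero] at hF
    subst hF
    simp [card_Ls]
  | succ n ih =>
    intro W F r hF hW h1 h2
    have hne : F.Nonempty := by rw [← Finset.card_pos]; omega
    obtain ⟨⟨u, v⟩, huv, hmin⟩ := Finset.exists_min_image F (fun p => r p.2) hne
    have hvdom : ∀ p ∈ F, p.1 ≠ v := by
      intro p hp hpv
      have := hmin p hp
      have h3 := (hW p hp).2.2
      rw [hpv] at h3
      simp at this; omega
    have huW := (hW _ huv).1
    have hvW := (hW _ huv).2.1
    simp only at huW hvW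
    have hne' : u ≠ v := hvdom _ huv
    have key := ih (W.erase v) (F.erase (u, v)) r (by rw [card_erase_of_mem huv]; omega)
      (by
        intro p hp
        rw [mem_erase] at hp
        refine ⟨mem_erase.2 ⟨hvdom p hp.2, (hW p hp.2).1⟩, mem_erase.2 ⟨?_, (hW p hp.2).2.1⟩,
          (hW p hp.2).2.2⟩
        intro h
        exact hp.1 (h2 p hp.2 _ huv h))
      (fun p hp q hq => h1 p (mem_of_mem_erase hp) q (mem_of_mem_erase hq))
      (fun p hp q hq => h2 p (mem_of_mem_erase hp) q (mem_of_mem_erase hq))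
    rw [card_erase_of_mem huv, card_erase_of_mem hvW] at key
    have hcW : 0 < W.card := Finset.card_pos.2 ⟨v, hvW⟩
    have e1 : W.card - 1 - (F.card - 1) = W.card - F.card := by omega
    rw [e1] at key
    rw [← key]
    have hxF : ∀ p ∈ F.erase (u, v), p.1 ≠ u ∧ p.1 ≠ v := by
      intro p hp
      rw [mem_erase] at hp
      exact ⟨fun h => hp.1 (h1 p hp.2 _ huv h), hvdom p hp.2⟩
    refine Finset.card_bij (fun l _ => l.erase v) ?_ ?_ ?_
    · intro l hl
      rw [mem_filter, mem_Ls] at hl ⊢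
      obtain ⟨⟨hnd, hlW⟩, hlF⟩ := hl
      obtain ⟨a, b, rfl⟩ := split_of_arc (hlF _ huv)
      have hva : v ∉ a := by
        intro h; simp [List.nodup_append] at hnd; grind
      have her : (a ++ u :: v :: b).erase v = a ++ u :: b := by
        rw [List.erase_append_right _ hva, List.erase_cons_tail (by simpa using hne')]
        simp
      refine ⟨⟨hnd.erase v, ?_⟩, ?_⟩
      · ext z
        rw [List.mem_toFinset, hnd.mem_erase_iff, mem_erase, ← hlW, List.mem_toFinset]
      · rw [her]
        intro p hp
        have := hxF p hp
        exact (arcs_insert this.1 this.2).1 (hlF p (mem_of_mem_erase hp))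
    · intro l hl l' hl' h
      rw [mem_filter, mem_Ls] at hl hl'
      obtain ⟨⟨hnd, hlW⟩, hlF⟩ := hl
      obtain ⟨⟨hnd', hlW'⟩, hlF'⟩ := hl'
      obtain ⟨a, b, rfl⟩ := split_of_arc (hlF _ huv)
      obtain ⟨a', b', rfl⟩ := split_of_arc (hlF' _ huv)
      have hva : v ∉ a := by
        intro h; simp [List.nodup_append] at hnd; grind
      have hva' : v ∉ a' := by
        intro h; simp [List.nodup_append] at hnd'; grind
      have hua : u ∉ a := by
        intro h; simp [List.nodup_append] at hnd; grind
      have hua' : u ∉ a' := by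
        intro h; simp [List.nodup_append] at hnd'; grind
      have her : ∀ a b : List V, v ∉ a → (a ++ u :: v :: b).erase v = a ++ u :: b := by
        intro a b hva
        rw [List.erase_append_right _ hva, List.erase_cons_tail (by simpa using hne')]
        simp
      replace h : (a ++ u :: v :: b).erase v = (a' ++ u :: v :: b').erase v := h
      rw [her a b hva, her a' b' hva'] at h
      have : a = a' ∧ b = b' := by
        have hlen : a.length = a'.length := by
          have := congrArg (List.idxOf u) h
          simpa [List.idxOf_append, hua, hua'] using this
        have := List.append_inj h hlen
        simpa using this
      rw [this.1, this.2]
    · intro l hl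
      rw [mem_filter, mem_Ls] at hl
      obtain ⟨⟨hnd, hlW⟩, hlF⟩ := hl
      have hul : u ∈ l := by
        rw [← List.mem_toFinset, hlW, mem_erase]; exact ⟨hne', huW⟩
      have hvl : v ∉ l := by
        rw [← List.mem_toFinset, hlW, mem_erase]; simp
      obtain ⟨a, b, rfl⟩ := List.append_of_mem hul
      have hperm : (a ++ u :: v :: b).Perm (v :: (a ++ u :: b)) := by
        have : a ++ u :: v :: b = (a ++ [u]) ++ v :: b := by simp
        rw [this]
        refine List.perm_middle.trans ?_
        simp
      refine ⟨a ++ u :: v :: b, ?_, ?_⟩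
      · rw [mem_filter, mem_Ls]
        refine ⟨⟨hperm.nodup_iff.2 (List.nodup_cons.2 ⟨hvl, hnd⟩), ?_⟩, ?_⟩
        · rw [List.toFinset_eq_of_perm _ _ hperm, List.toFinset_cons, hlW, insert_erase hvW]
        · intro p hp
          by_cases hpe : p = (u, v)
          · rw [hpe]; exact arcs_mid a b u v
          · have hp' := mem_erase.2 ⟨hpe, hp⟩
            have := hxF p hp'
            exact (arcs_insert this.1 this.2).2 (hlF p hp')
      · have hva : v ∉ a := fun h => hvl (by simp [h])
        rw [List.erase_append_right _ hva, List.erase_cons_tail (by simpa using hne')]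
        simp
end RB

namespace RB
open Finset
variable {V : Type*} [DecidableEq V] [Fintype V]

lemma arcs_inj {l : List V} (hnd : l.Nodup) :
    (∀ p ∈ arcs l, ∀ q ∈ arcs l, p.1 = q.1 → p = q) ∧
    (∀ p ∈ arcs l, ∀ q ∈ arcs l, p.2 = q.2 → p = q) := by
  constructor
  · rintro ⟨x, y⟩ hp ⟨x', y'⟩ hq h
    obtain ⟨i, hi, rfl, rfl⟩ := mem_arcs_iff.1 hp
    obtain ⟨j, hj, rfl, rfl⟩ := mem_arcs_iff.1 hq
    have : i = j := (hnd.getElem_inj_iff).1 h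
    subst this; rfl
  · rintro ⟨x, y⟩ hp ⟨x', y'⟩ hq h
    obtain ⟨i, hi, rfl, rfl⟩ := mem_arcs_iff.1 hp
    obtain ⟨j, hj, rfl, rfl⟩ := mem_arcs_iff.1 hq
    have : i + 1 = j + 1 := (hnd.getElem_inj_iff).1 h
    have : i = j := by omega
    subst this; rfl

lemma count_perms (F : Finset (V × V)) (l : List V) (hnd : l.Nodup)
    (hF : ∀ p ∈ F, p ∈ arcs l) :
    (univ.filter (fun σ : Equiv.Perm V => ∀ p ∈ F, σ p.1 = p.2)).card =
      (Fintype.card V - F.card).factorial := by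
  have hτ : ∀ p ∈ F, l.formPerm p.1 = p.2 := by
    rintro ⟨x, y⟩ hp
    obtain ⟨i, hi, rfl, rfl⟩ := mem_arcs_iff.1 (hF _ hp)
    exact List.formPerm_apply_lt_getElem l hnd i hi
  set τ := l.formPerm
  set D := F.image Prod.fst with hD
  have hDc : D.card = F.card := Finset.card_image_of_injOn (fun p hp q hq h =>
    (arcs_inj hnd).1 p (hF p hp) q (hF q hq) h)
  have h1 : (univ.filter (fun σ : Equiv.Perm V => ∀ p ∈ F, σ p.1 = p.2)).card =
      (univ.filter (fun σ : Equiv.Perm V => ∀ a, ¬ (a ∉ D) → σ a = a)).card := by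
    refine Finset.card_bij (fun σ _ => τ⁻¹ * σ) ?_ ?_ ?_
    · intro σ hσ
      simp only [mem_filter, mem_univ, true_and, not_not, hD, mem_image] at hσ ⊢
      rintro a ⟨p, hp, rfl⟩
      rw [Equiv.Perm.mul_apply, hσ p hp, Equiv.Perm.inv_eq_iff_eq, hτ p hp]
    · intro σ _ σ' _ h
      exact mul_left_cancel h
    · intro ρ hρ
      simp only [mem_filter, mem_univ, true_and, not_not, hD, mem_image] at hρ
      refine ⟨τ * ρ, ?_, by simp⟩
      simp only [mem_filter, mem_univ, true_and]
      intro p hp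
      rw [Equiv.Perm.mul_apply, hρ p.1 ⟨p, hp, rfl⟩, hτ p hp]
  rw [h1, ← Fintype.card_subtype,
    ← Fintype.card_congr (Equiv.Perm.subtypeEquivSubtypePerm (fun a => a ∉ D)),
    Fintype.card_perm]
  congr 1
  rw [Fintype.card_subtype_compl, Fintype.card_coe, hDc]

/-- the orbit of `x` as a finset -/
noncomputable def orb (σ : Equiv.Perm V) (x : V) : Finset V :=
  by classical exact univ.filter (fun y => σ.SameCycle x y)

lemma mem_orb {σ : Equiv.Perm V} {x y : V} : y ∈ orb σ x ↔ σ.SameCycle x y := by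
  simp [orb]

lemma orb_eq {σ : Equiv.Perm V} {x y : V} (h : y ∈ orb σ x) : orb σ y = orb σ x := by
  rw [mem_orb] at h
  ext z; rw [mem_orb, mem_orb]
  exact ⟨h.trans, h.symm.trans⟩

lemma self_mem_orb (σ : Equiv.Perm V) (x : V) : x ∈ orb σ x := mem_orb.2 (.refl _ _)

/-- arcs of σ starting in D -/
def gr (σ : Equiv.Perm V) (D : Finset V) : Finset (V × V) := D.image (fun x => (x, σ x))

lemma linear_iff (σ : Equiv.Perm V) (D : Finset V) :
    (∃ l ∈ Ls (univ : Finset V), ∀ p ∈ gr σ D, p ∈ arcs l) ↔ ∀ x, ¬ orb σ x ⊆ D := by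
  constructor
  · rintro ⟨l, hl, h⟩ x hx
    rw [mem_Ls] at hl
    obtain ⟨y, hy, hmax⟩ := Finset.exists_max_image (orb σ x) (fun z => l.idxOf z)
      ⟨x, self_mem_orb σ x⟩
    have hσ : σ y ∈ orb σ x := by
      rw [mem_orb] at hy ⊢; exact Equiv.Perm.sameCycle_apply_right.2 hy
    have h1 := hmax _ hσ
    obtain ⟨i, hi, h2, h3⟩ := mem_arcs_iff.1 (h (y, σ y) (mem_image.2 ⟨y, hx hy, rfl⟩))
    rw [← h3, ← h2, hl.1.idxOf_getElem, hl.1.idxOf_getElem] at h1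
    omega
  · intro h
    have hex : ∀ x, ∃ k : ℕ, (σ ^ k) x ∉ D := by
      intro x
      by_contra hc
      push Not at hc
      refine h x fun y hy => ?_
      rw [mem_orb] at hy
      obtain ⟨k, rfl⟩ := hy.exists_nat_pow_eq
      exact hc k
    have hcount := count_listings (gr σ D).card univ (gr σ D) (fun x => Nat.find (hex x)) rfl
      (by
        intro p hp
        obtain ⟨x, hx, rfl⟩ := mem_image.1 hp
        refine ⟨mem_univ _, mem_univ _, ?_⟩
        have hs := Nat.find_spec (hex x)
        have h0 : Nat.find (hex x) ≠ 0 := by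
          intro h0; rw [h0] at hs; exact hs (by simpa using hx)
        obtain ⟨k, hk⟩ := Nat.exists_eq_succ_of_ne_zero h0
        rw [hk] at hs
        have : Nat.find (hex (σ x)) ≤ k := by
          apply Nat.find_min'
          rw [pow_succ, Equiv.Perm.mul_apply] at hs
          exact hs
        simp only
        omega)
      (by
        intro p hp q hq hpq
        obtain ⟨x, hx, rfl⟩ := mem_image.1 hp
        obtain ⟨y, hy, rfl⟩ := mem_image.1 hq
        simp_all)
      (by
        intro p hp q hq hpq
        obtain ⟨x, hx, rfl⟩ := mem_image.1 hp
        obtain ⟨y, hy, rfl⟩ := mem_image.1 hq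
        simp_all)
    have hpos : 0 < ((Ls (univ : Finset V)).filter (fun l => ∀ p ∈ gr σ D, p ∈ arcs l)).card := by
      refine lt_of_lt_of_eq (Nat.factorial_pos ((univ : Finset V).card - (gr σ D).card)) ?_
      rw [← hcount]
      congr!
    obtain ⟨l, hl⟩ := Finset.card_pos.1 hpos
    exact ⟨l, (mem_filter.1 hl).1, (mem_filter.1 hl).2⟩

/-- if some listing contains F, the number of listings containing F equals the number of
permutations extending F -/
lemma count_eq (F : Finset (V × V)) (h : ∃ l ∈ Ls (univ : Finset V), ∀ p ∈ F, p ∈ arcs l) :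
    ((Ls (univ : Finset V)).filter (fun l => ∀ p ∈ F, p ∈ arcs l)).card =
    (univ.filter (fun σ : Equiv.Perm V => ∀ p ∈ F, σ p.1 = p.2)).card := by
  obtain ⟨l, hl, h⟩ := h
  rw [mem_Ls] at hl
  rw [count_perms F l hl.1 h, ← Finset.card_univ]
  refine Eq.trans (by congr!) (count_listings _ univ F (fun x => l.length - l.idxOf x) rfl ?_ ?_ ?_)
  · rintro ⟨x, y⟩ hp
    refine ⟨mem_univ _, mem_univ _, ?_⟩
    obtain ⟨i, hi, rfl, rfl⟩ := mem_arcs_iff.1 (h _ hp)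
    simp only [hl.1.idxOf_getElem]
    omega
  · exact fun p hp q hq => (arcs_inj hl.1).1 p (h p hp) q (h q hq)
  · exact fun p hp q hq => (arcs_inj hl.1).2 p (h p hp) q (h q hq)

lemma sum_between (U A : Finset V) :
    ∑ D ∈ A.powerset.filter (fun D => U ⊆ D), (-1 : ℚ) ^ D.card =
      if U = A then (-1 : ℚ) ^ A.card else 0 := by
  split_ifs with h
  · subst h
    rw [Finset.sum_eq_single U]
    · intro D hD hne
      rw [mem_filter, mem_powerset] at hD
      exact absurd (Subset.antisymm hD.1 hD.2) hne
    · simp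
  · by_cases hUA : U ⊆ A
    · have : ∃ a ∈ A, a ∉ U := by
        by_contra hc; push Not at hc; exact h (Subset.antisymm hUA hc)
      obtain ⟨a, haA, haU⟩ := this
      refine Finset.sum_involution (fun D _ => if a ∈ D then D.erase a else insert a D) ?_ ?_ ?_ ?_
      · intro D hD
        split_ifs with haD
        · rw [card_erase_of_mem haD]
          have := Finset.card_pos.2 ⟨a, haD⟩
          obtain ⟨k, hk⟩ := Nat.exists_eq_succ_of_ne_zero this.ne'
          rw [hk, pow_succ]; simp
        · rw [card_insert_of_notMem haD, pow_succ]; simp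
      · intro D hD _ he
        split_ifs at he with haD
        · exact (Finset.erase_ne_self.2 haD) he
        · exact haD (by rw [← he]; simp)
      · intro D hD
        rw [mem_filter, mem_powerset] at hD ⊢
        split_ifs with haD
        · refine ⟨(erase_subset _ _).trans hD.1, fun z hz => mem_erase.2 ⟨?_, hD.2 hz⟩⟩
          rintro rfl; exact haU hz
        · exact ⟨insert_subset haA hD.1, hD.2.trans (subset_insert _ _)⟩
      · intro D hD
        by_cases haD : a ∈ D
        · simp [haD]
        · simp [haD]
    · rw [Finset.filter_eq_empty_iff.2, sum_empty]
      intro D hD hU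
      exact hUA (hU.trans (mem_powerset.1 hD))

lemma sum_powerset_rat {α : Type*} [DecidableEq α] (x : Finset α) :
    ∑ m ∈ x.powerset, (-1 : ℚ) ^ m.card = if x = ∅ then 1 else 0 := by
  have := congrArg (Int.cast : ℤ → ℚ) (Finset.sum_powerset_neg_one_pow_card (x := x))
  push_cast at this
  exact this

/-- all the orbits -/
noncomputable def orbs (σ : Equiv.Perm V) : Finset (Finset V) := univ.image (orb σ)

open Classical in
lemma sum_no_orbit (σ : Equiv.Perm V) (A : Finset V) :
    ∑ D ∈ A.powerset.filter (fun D => ∀ x, ¬ orb σ x ⊆ D), (-1 : ℚ) ^ D.card =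
      if (∀ x ∈ A, orb σ x ⊆ A) then
        (-1 : ℚ) ^ (∑ s ∈ (orbs σ).filter (fun s => s ⊆ A), (s.card - 1)) else 0 := by
  have h1 : ∀ D : Finset V, (if ∀ x, ¬ orb σ x ⊆ D then (1:ℚ) else 0) =
      ∑ T ∈ (orbs σ).powerset, if T.biUnion id ⊆ D then (-1:ℚ) ^ T.card else 0 := by
    intro D
    rw [← Finset.sum_filter]
    have : (orbs σ).powerset.filter (fun T => T.biUnion id ⊆ D) =
        ((orbs σ).filter (fun s => s ⊆ D)).powerset := by
      ext T
      simp only [mem_filter, mem_powerset, biUnion_subset, id, subset_iff (s₁ := T)]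
      exact ⟨fun h s hs => ⟨h.1 hs, h.2 s hs⟩, fun h => ⟨fun s hs => (h hs).1, fun s hs => (h hs).2⟩⟩
    rw [this, sum_powerset_rat]
    congr 1
    rw [Finset.filter_eq_empty_iff]
    simp [orbs]
  rw [Finset.sum_filter]
  have h2 : ∀ D ∈ A.powerset, (if ∀ x, ¬ orb σ x ⊆ D then (-1 : ℚ) ^ D.card else 0) =
      ∑ T ∈ (orbs σ).powerset, (-1:ℚ) ^ T.card * (if T.biUnion id ⊆ D then (-1:ℚ) ^ D.card else 0) := by
    intro D _
    have := congrArg (fun t => t * (-1 : ℚ) ^ D.card) (h1 D)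
    simp only [ite_mul, one_mul, zero_mul, Finset.sum_mul] at this
    rw [this]
    refine Finset.sum_congr rfl fun T _ => ?_
    split_ifs <;> simp
  rw [Finset.sum_congr rfl h2, Finset.sum_comm]
  have h3 : ∀ T ∈ (orbs σ).powerset, ∑ D ∈ A.powerset,
      (-1:ℚ) ^ T.card * (if T.biUnion id ⊆ D then (-1:ℚ) ^ D.card else 0) =
      if T.biUnion id = A then (-1:ℚ) ^ T.card * (-1:ℚ) ^ A.card else 0 := by
    intro T _
    rw [← Finset.mul_sum, ← Finset.sum_filter, sum_between]
    split_ifs <;> simp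
  rw [Finset.sum_congr rfl h3]
  have hdisj : ∀ s ∈ orbs σ, ∀ t ∈ orbs σ, ∀ x, x ∈ s → x ∈ t → s = t := by
    intro s hs t ht x hxs hxt
    obtain ⟨y, _, rfl⟩ := mem_image.1 hs
    obtain ⟨z, _, rfl⟩ := mem_image.1 ht
    rw [← orb_eq hxs, ← orb_eq hxt]
  have hnon : ∀ s ∈ orbs σ, s.Nonempty := by
    intro s hs
    obtain ⟨y, _, rfl⟩ := mem_image.1 hs
    exact ⟨y, self_mem_orb _ _⟩
  have hTA : ∀ T ∈ (orbs σ).powerset, T.biUnion id = A → T = (orbs σ).filter (fun s => s ⊆ A) := by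
    intro T hT h
    rw [mem_powerset] at hT
    ext s
    rw [mem_filter]
    constructor
    · intro hs
      refine ⟨hT hs, ?_⟩
      rw [← h]; exact Finset.subset_biUnion_of_mem id hs
    · rintro ⟨hs, hsA⟩
      obtain ⟨x, hx⟩ := hnon s hs
      have := hsA hx
      rw [← h, mem_biUnion] at this
      obtain ⟨t, ht, hxt⟩ := this
      rw [hdisj s hs t (hT ht) x hx hxt]; exact ht
  split_ifs with hA
  · have hU : ((orbs σ).filter (fun s => s ⊆ A)).biUnion id = A := by
      ext x
      simp only [mem_biUnion, mem_filter, id]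
      constructor
      · rintro ⟨s, ⟨_, hs⟩, hx⟩; exact hs hx
      · intro hx
        exact ⟨orb σ x, ⟨mem_image_of_mem _ (mem_univ _), hA x hx⟩, self_mem_orb _ _⟩
    rw [Finset.sum_eq_single_of_mem ((orbs σ).filter (fun s => s ⊆ A))
      (mem_powerset.2 (filter_subset _ _)), if_pos hU]
    · set T := (orbs σ).filter (fun s => s ⊆ A) with hT
      have hc : A.card = ∑ s ∈ T, s.card := by
        rw [← hU]
        exact Finset.card_biUnion (fun s hs t ht hne => by
          rw [Function.onFun, Finset.disjoint_left]
          intro x hx hx'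
          exact hne (hdisj s (mem_filter.1 hs).1 t (mem_filter.1 ht).1 x hx hx'))
      have hc2 : A.card = ∑ s ∈ T, (s.card - 1) + T.card := by
        rw [hc, Finset.card_eq_sum_ones T, ← Finset.sum_add_distrib]
        refine Finset.sum_congr rfl fun s hs => ?_
        have := Finset.card_pos.2 (hnon s (mem_filter.1 hs).1)
        omega
      rw [hc2, pow_add, mul_comm, mul_assoc, ← pow_add, ← two_mul, pow_mul]
      simp
    · intro T hT hne
      rw [if_neg]
      intro h; exact hne (hTA T hT h)
  · refine Finset.sum_eq_zero fun T hT => ?_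
    rw [if_neg]
    intro h
    apply hA
    intro x hx
    rw [← h, mem_biUnion] at hx
    obtain ⟨s, hs, hxs⟩ := hx
    obtain ⟨y, _, rfl⟩ := mem_image.1 (mem_powerset.1 hT hs)
    rw [orb_eq hxs, ← h]
    exact Finset.subset_biUnion_of_mem id hs

end RB

namespace RB
open Finset
variable {V : Type*} [DecidableEq V] [Fintype V]

lemma support_eq_orb {σ c : Equiv.Perm V} (hc : c ∈ σ.cycleFactorsFinset) {x : V}
    (hx : x ∈ c.support) : c.support = orb σ x := by
  have h := (Equiv.Perm.eq_cycleOf_of_mem_cycleFactorsFinset_iff σ c hc x).2 hx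
  have hxs : x ∈ σ.support := Equiv.Perm.mem_cycleFactorsFinset_support_le hc hx
  ext y
  rw [h, Equiv.Perm.mem_support_cycleOf_iff' (Equiv.Perm.mem_support.1 hxs), mem_orb]

lemma apply_of_mem {σ c : Equiv.Perm V} (hc : c ∈ σ.cycleFactorsFinset) {x : V}
    (hx : x ∈ c.support) : c x = σ x :=
  (Equiv.Perm.mem_cycleFactorsFinset_iff.1 hc).2 x hx

lemma support_inj {σ c d : Equiv.Perm V} (hc : c ∈ σ.cycleFactorsFinset)
    (hd : d ∈ σ.cycleFactorsFinset) (h : c.support = d.support) : c = d := by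
  ext x
  by_cases hx : x ∈ c.support
  · rw [apply_of_mem hc hx, apply_of_mem hd (h ▸ hx)]
  · have hx' : x ∉ d.support := h ▸ hx
    rw [Equiv.Perm.notMem_support.1 hx, Equiv.Perm.notMem_support.1 hx']

lemma fixed_orb {σ : Equiv.Perm V} {x : V} (h : σ x = x) : orb σ x = {x} := by
  ext y
  rw [mem_orb, mem_singleton]
  constructor
  · rintro ⟨k, rfl⟩
    exact Equiv.Perm.zpow_apply_eq_self_of_apply_eq_self h k
  · rintro rfl; exact .refl _ _

lemma exists_cycle {σ : Equiv.Perm V} {x : V} (h : σ x ≠ x) :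
    ∃ c ∈ σ.cycleFactorsFinset, x ∈ c.support ∧ c.support = orb σ x := by
  have hc : σ.cycleOf x ∈ σ.cycleFactorsFinset :=
    Equiv.Perm.cycleOf_mem_cycleFactorsFinset_iff.2 (Equiv.Perm.mem_support.2 h)
  have hx : x ∈ (σ.cycleOf x).support :=
    (Equiv.Perm.mem_support_cycleOf_iff' h).2 (.refl _ _)
  exact ⟨_, hc, hx, support_eq_orb hc hx⟩

open Classical in
/-- sources of E-arcs of σ -/
noncomputable def srcs (E : Set (V × V)) (σ : Equiv.Perm V) : Finset V :=
  univ.filter (fun x => (x, σ x) ∈ E)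

lemma mem_srcs {E : Set (V × V)} {σ : Equiv.Perm V} {x : V} : x ∈ srcs E σ ↔ (x, σ x) ∈ E := by
  simp [srcs]

lemma isDigraphCycle_iff {E : Set (V × V)} {σ c : Equiv.Perm V} (hc : c ∈ σ.cycleFactorsFinset) :
    IsDigraphCycle E c ↔ c.support ⊆ srcs E σ := by
  unfold IsDigraphCycle
  refine forall₂_congr fun x hx => ?_
  rw [mem_srcs, apply_of_mem hc hx]

lemma mem_iff (E : Set (V × V)) (σ : Equiv.Perm V) :
    MemSVXXbar E σ ↔ ∀ x ∈ srcs E σ, orb σ x ⊆ srcs E σ := by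
  constructor
  · intro h x hx
    by_cases hfix : σ x = x
    · rw [fixed_orb hfix]; simpa using hx
    · obtain ⟨c, hc, hxc, hs⟩ := exists_cycle hfix
      rcases h c hc with h | h
      · rw [← hs]; exact (isDigraphCycle_iff hc).1 h
      · have := h x hxc
        rw [apply_of_mem hc hxc] at this
        exact absurd (mem_srcs.1 hx) this
  · intro h c hc
    by_cases hE : IsDigraphCycle E c
    · exact Or.inl hE
    · right
      intro x hx
      rw [apply_of_mem hc hx]
      intro hxE
      apply hE
      rw [isDigraphCycle_iff hc, support_eq_orb hc hx]
      exact h x (mem_srcs.2 hxE)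

lemma phi_eq (E : Set (V × V)) (σ : Equiv.Perm V) :
    phi E σ = ∑ s ∈ (orbs σ).filter (fun s => s ⊆ srcs E σ), (s.card - 1) := by
  classical
  unfold phi
  rw [← Finset.sum_image (s := σ.cycleFactorsFinset.filter (fun c => IsDigraphCycle E c))
    (g := fun c => c.support) (f := fun s => s.card - 1)]
  · refine Finset.sum_subset ?_ ?_
    · intro s hs
      obtain ⟨c, hc, rfl⟩ := mem_image.1 hs
      rw [mem_filter] at hc
      rw [mem_filter]
      refine ⟨?_, (isDigraphCycle_iff hc.1).1 hc.2⟩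
      have hcyc := (Equiv.Perm.mem_cycleFactorsFinset_iff.1 hc.1).1
      obtain ⟨x, hx⟩ := hcyc.nonempty_support
      rw [support_eq_orb hc.1 hx]
      exact mem_image_of_mem _ (mem_univ _)
    · intro s hs hns
      rw [mem_filter] at hs
      obtain ⟨x, _, rfl⟩ := mem_image.1 hs.1
      by_cases hfix : σ x = x
      · rw [fixed_orb hfix]; simp
      · obtain ⟨c, hc, hxc, hcs⟩ := exists_cycle hfix
        exfalso
        apply hns
        refine mem_image.2 ⟨c, mem_filter.2 ⟨hc, ?_⟩, hcs⟩
        rw [isDigraphCycle_iff hc, hcs]; exact hs.2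
  · intro c hc d hd h
    exact support_inj (mem_filter.1 (mem_coe.1 hc)).1 (mem_filter.1 (mem_coe.1 hd)).1 h

open Classical in
theorem core (E : Set (V × V)) :
    (((Ls (univ : Finset V)).filter (fun l => ∀ p ∈ arcs l, p ∉ E)).card : ℚ) =
      ∑ σ : Equiv.Perm V, if MemSVXXbar E σ then (-1 : ℚ) ^ phi E σ else 0 := by
  set EE : Finset (V × V) := univ.filter (fun p => p ∈ E) with hEE
  have hL : (((Ls (univ : Finset V)).filter (fun l => ∀ p ∈ arcs l, p ∉ E)).card : ℚ) =
      ∑ F ∈ EE.powerset, (-1 : ℚ) ^ F.card *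
        ((Ls (univ : Finset V)).filter (fun l => ∀ p ∈ F, p ∈ arcs l)).card := by
    have h1 : ∀ F ∈ EE.powerset, (-1 : ℚ) ^ F.card *
        ((Ls (univ : Finset V)).filter (fun l => ∀ p ∈ F, p ∈ arcs l)).card =
        ∑ l ∈ Ls (univ : Finset V), if ∀ p ∈ F, p ∈ arcs l then (-1 : ℚ) ^ F.card else 0 := by
      intro F _
      rw [← Finset.sum_filter, Finset.sum_const, nsmul_eq_mul, mul_comm]
    rw [Finset.sum_congr rfl h1, Finset.sum_comm, Finset.card_filter]
    push_cast
    refine Finset.sum_congr rfl fun l _ => ?_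
    rw [← Finset.sum_filter]
    have : EE.powerset.filter (fun F => ∀ p ∈ F, p ∈ arcs l) =
        (EE.filter (fun p => p ∈ arcs l)).powerset := by
      ext F
      simp only [mem_filter, mem_powerset, subset_iff]
      exact ⟨fun h p hp => ⟨h.1 hp, h.2 p hp⟩, fun h => ⟨fun p hp => (h hp).1, fun p hp => (h hp).2⟩⟩
    rw [this, sum_powerset_rat]
    refine if_congr ?_ rfl rfl
    rw [Finset.filter_eq_empty_iff]
    simp only [hEE, mem_filter, mem_univ, true_and]
    exact ⟨fun h p hp hl => h p hl hp, fun h p hp hl => h hl hp⟩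
  rw [hL]
  have hR : ∀ σ : Equiv.Perm V, (if MemSVXXbar E σ then (-1 : ℚ) ^ phi E σ else 0) =
      ∑ F ∈ EE.powerset, if (∃ l ∈ Ls (univ : Finset V), ∀ p ∈ F, p ∈ arcs l) ∧
        (∀ p ∈ F, σ p.1 = p.2) then (-1 : ℚ) ^ F.card else 0 := by
    intro σ
    have h := sum_no_orbit σ (srcs E σ)
    have h' : (if MemSVXXbar E σ then (-1 : ℚ) ^ phi E σ else 0) =
      ∑ D ∈ (srcs E σ).powerset.filter (fun D => ∀ x, ¬ orb σ x ⊆ D), (-1 : ℚ) ^ D.card := by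
      rw [h, phi_eq]
      exact if_congr (mem_iff E σ) rfl rfl
    rw [h', ← Finset.sum_filter]
    have hinj : Function.Injective (fun x => (x, σ x)) := fun x y hxy => by simpa using hxy
    refine Finset.sum_bij (fun D _ => gr σ D) ?_ ?_ ?_ ?_
    · intro D hD
      rw [mem_filter, mem_powerset] at hD ⊢
      refine ⟨?_, (linear_iff σ D).2 hD.2, ?_⟩
      · intro p hp
        obtain ⟨x, hx, rfl⟩ := mem_image.1 hp
        simpa [hEE] using mem_srcs.1 (hD.1 hx)
      · intro p hp
        obtain ⟨x, hx, rfl⟩ := mem_image.1 hp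
        rfl
    · intro D _ D' _ h
      exact Finset.image_injective hinj h
    · intro F hF
      rw [mem_filter, mem_powerset] at hF
      obtain ⟨hFE, hl, hσ⟩ := hF
      have hgr : gr σ (F.image Prod.fst) = F := by
        unfold gr
        rw [Finset.image_image]
        conv_rhs => rw [← Finset.image_id (s := F)]
        refine Finset.image_congr fun p hp => ?_
        simp only [Function.comp, id]
        rw [hσ p hp]
      refine ⟨F.image Prod.fst, ?_, hgr⟩
      rw [mem_filter, mem_powerset]
      refine ⟨?_, ?_⟩
      · intro x hx
        obtain ⟨p, hp, rfl⟩ := mem_image.1 hx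
        rw [mem_srcs, hσ p hp]
        simpa [hEE] using hFE hp
      · rw [← linear_iff, hgr]; exact hl
    · intro D _
      rw [gr, Finset.card_image_of_injective _ hinj]
  rw [Finset.sum_congr rfl (fun σ _ => hR σ), Finset.sum_comm]
  refine Finset.sum_congr rfl fun F _ => ?_
  by_cases hl : ∃ l ∈ Ls (univ : Finset V), ∀ p ∈ F, p ∈ arcs l
  · simp only [hl, true_and]
    rw [count_eq F hl, ← Finset.sum_filter, Finset.sum_const, nsmul_eq_mul, mul_comm]
  · simp only [hl, false_and, if_false, Finset.sum_const_zero]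
    rw [Finset.filter_eq_empty_iff.2]
    · simp
    · intro l hl1 hl2
      exact hl ⟨l, hl1, hl2⟩

/-- the modified digraph encoding the coloring -/
def colE (E : Set (V × V)) (f : V → ℕ+) : Set (V × V) :=
  {p | f p.2 < f p.1 ∨ (f p.1 = f p.2 ∧ p ∈ E)}

lemma friendly_iff (E : Set (V × V)) (f : V → ℕ+) (σ : Fin (Fintype.card V) ≃ V) :
    Friendly E f σ ↔ ∀ p ∈ arcs (List.ofFn σ), p ∉ colE E f := by
  constructor
  · rintro ⟨hm, hE⟩ ⟨x, y⟩ hp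
    obtain ⟨i, hi, rfl, rfl⟩ := mem_arcs_iff.1 hp
    simp only [List.length_ofFn] at hi
    simp only [List.getElem_ofFn, colE, Set.mem_ofPred_eq, not_or, not_and, not_lt]
    have h1 := hm (show (⟨i, by omega⟩ : Fin (Fintype.card V)) ≤ ⟨i + 1, hi⟩ by simp)
    exact ⟨h1, fun h2 h3 => (hE ⟨i, by omega⟩ hi h3).ne h2⟩
  · intro h
    have key : ∀ i (hi : i + 1 < Fintype.card V),
        (σ ⟨i, by omega⟩, σ ⟨i + 1, hi⟩) ∉ colE E f := by
      intro i hi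
      apply h
      rw [mem_arcs_iff]
      exact ⟨i, by simpa using hi, by simp, by simp⟩
    simp only [colE, Set.mem_ofPred_eq, not_or, not_and, not_lt] at key
    refine ⟨?_, ?_⟩
    · have : ∀ k i (hk : i + k < Fintype.card V), f (σ ⟨i, by omega⟩) ≤ f (σ ⟨i + k, hk⟩) := by
        intro k
        induction k with
        | zero => intro i hk; exact le_rfl
        | succ k ih => intro i hk; exact (ih i (by omega)).trans (key (i + k) hk).1
      rintro ⟨i, hi⟩ ⟨j, hj⟩ hij
      obtain ⟨k, rfl⟩ := Nat.exists_eq_add_of_le (show i ≤ j from hij)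
      exact this k i hj
    · intro i hi hE
      have := key i hi
      exact lt_of_le_of_ne this.1 fun h => this.2 h hE

open Classical in
lemma count_listing_eq (E : Set (V × V)) (f : V → ℕ+) :
    redeiBergeCount E f =
      ((Ls (univ : Finset V)).filter (fun l => ∀ p ∈ arcs l, p ∉ colE E f)).card := by
  unfold redeiBergeCount
  rw [Nat.card_eq_fintype_card, Fintype.card_subtype]
  refine Finset.card_bij (fun σ _ => List.ofFn σ) ?_ ?_ ?_
  · intro σ hσ
    rw [mem_filter] at hσ ⊢
    refine ⟨mem_Ls.2 ⟨List.nodup_ofFn.2 σ.injective, ?_⟩, (friendly_iff E f σ).1 hσ.2⟩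
    ext x
    simp only [List.mem_toFinset, List.mem_ofFn', mem_univ, iff_true]
    exact σ.surjective x
  · intro σ _ τ _ h
    exact Equiv.ext (congrFun (List.ofFn_injective h))
  · intro l hl
    rw [mem_filter, mem_Ls] at hl
    obtain ⟨⟨hnd, hu⟩, hl⟩ := hl
    have hlen : l.length = Fintype.card V := by
      rw [← List.toFinset_card_of_nodup hnd, hu, Finset.card_univ]
    let e : Fin l.length ≃ V := hnd.getEquivOfForallMemList l (fun x => by
      rw [← List.mem_toFinset, hu]; exact mem_univ x)
    have hof : List.ofFn ((finCongr hlen.symm).trans e) = l := by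
      refine List.ext_getElem (by simp [hlen]) ?_
      intro i h1 h2
      simp [e]
    refine ⟨(finCongr hlen.symm).trans e, ?_, hof⟩
    rw [mem_filter, friendly_iff, hof]
    exact ⟨mem_univ _, hl⟩

lemma const_of_mono {α : Type*} [LinearOrder α] {σ : Equiv.Perm V} {f : V → α} {s : Finset V}
    (hs : ∀ x ∈ s, σ x ∈ s) (h : ∀ x ∈ s, f x ≤ f (σ x)) : ∀ x ∈ s, f x = f (σ x) := by
  have hsurj : s.map σ.toEmbedding = s := by
    apply Finset.eq_of_subset_of_card_le
    · intro y hy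
      obtain ⟨x, hx, rfl⟩ := mem_map.1 hy
      exact hs x hx
    · rw [card_map]
  intro x hx
  refine le_antisymm (h x hx) ?_
  -- iterate around the cycle
  have hpow : ∀ k : ℕ, (σ ^ k) x ∈ s ∧ f (σ x) ≤ f ((σ ^ (k + 1)) x) := by
    intro k
    induction k with
    | zero => simpa using hx
    | succ k ih =>
      have h1 : (σ ^ (k + 1)) x ∈ s := by
        rw [pow_succ', Equiv.Perm.mul_apply]; exact hs _ ih.1
      refine ⟨h1, ih.2.trans ?_⟩
      rw [pow_succ' σ (k + 1), Equiv.Perm.mul_apply]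
      exact h _ h1
  have hpos := orderOf_pos σ
  have := (hpow (orderOf σ - 1)).2
  rw [Nat.sub_add_cancel hpos, pow_orderOf_eq_one] at this
  exact this

lemma stable_support {σ c : Equiv.Perm V} (hc : c ∈ σ.cycleFactorsFinset) :
    ∀ x ∈ c.support, σ x ∈ c.support := by
  intro x hx
  rw [← apply_of_mem hc hx]
  exact Equiv.Perm.apply_mem_support.2 hx

lemma cyc_col (E : Set (V × V)) (f : V → ℕ+) {σ c : Equiv.Perm V}
    (hc : c ∈ σ.cycleFactorsFinset) :
    IsDigraphCycle (colE E f) c ↔ IsDigraphCycle E c ∧ ∀ x ∈ c.support, f x = f (σ x) := by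
  constructor
  · intro h
    have h1 : ∀ x ∈ c.support, OrderDual.toDual (f x) = OrderDual.toDual (f (σ x)) := by
      refine const_of_mono (f := fun x => OrderDual.toDual (f x)) (stable_support hc) ?_
      intro x hx
      have := h x hx
      rw [apply_of_mem hc hx] at this
      rcases this with h | h
      · exact h.le
      · exact h.1.ge
    have h1' : ∀ x ∈ c.support, f x = f (σ x) := h1
    refine ⟨fun x hx => ?_, h1'⟩
    rcases h x hx with h | h
    · rw [apply_of_mem hc hx] at h
      exact absurd (h1' x hx) h.ne'
    · exact h.2
  · rintro ⟨h1, h2⟩ x hx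
    right
    refine ⟨?_, h1 x hx⟩
    rw [apply_of_mem hc hx]; exact h2 x hx

lemma cyc_col_compl (E : Set (V × V)) (f : V → ℕ+) {σ c : Equiv.Perm V}
    (hc : c ∈ σ.cycleFactorsFinset) :
    IsDigraphCycle (colE E f)ᶜ c ↔ IsDigraphCycle Eᶜ c ∧ ∀ x ∈ c.support, f x = f (σ x) := by
  constructor
  · intro h
    have h1' : ∀ x ∈ c.support, f x = f (σ x) := by
      refine const_of_mono (stable_support hc) ?_
      intro x hx
      have := h x hx
      rw [apply_of_mem hc hx] at this
      simp only [colE, Set.mem_compl_iff, Set.mem_ofPred_eq, not_or, not_lt] at this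
      exact this.1
    refine ⟨fun x hx hE => h x hx ?_, h1'⟩
    right
    refine ⟨?_, hE⟩
    rw [apply_of_mem hc hx]; exact h1' x hx
  · rintro ⟨h1, h2⟩ x hx h
    have h3 := h2 x hx
    rw [← apply_of_mem hc hx] at h3
    rcases h with h | h
    · exact h.ne' h3
    · exact h1 x hx h.2

lemma mem_col (E : Set (V × V)) (f : V → ℕ+) (σ : Equiv.Perm V) :
    MemSVXXbar (colE E f) σ ↔ MemSVXXbar E σ ∧ ∀ x, f x = f (σ x) := by
  unfold MemSVXXbar
  constructor
  · intro h
    refine ⟨fun c hc => ?_, fun x => ?_⟩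
    · rcases h c hc with h | h
      · exact Or.inl ((cyc_col E f hc).1 h).1
      · exact Or.inr ((cyc_col_compl E f hc).1 h).1
    · by_cases hfix : σ x = x
      · rw [hfix]
      · obtain ⟨c, hc, hxc, -⟩ := exists_cycle hfix
        rcases h c hc with h | h
        · exact ((cyc_col E f hc).1 h).2 x hxc
        · exact ((cyc_col_compl E f hc).1 h).2 x hxc
  · rintro ⟨h, hf⟩ c hc
    rcases h c hc with h | h
    · exact Or.inl ((cyc_col E f hc).2 ⟨h, fun x _ => hf x⟩)
    · exact Or.inr ((cyc_col_compl E f hc).2 ⟨h, fun x _ => hf x⟩)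

lemma phi_col (E : Set (V × V)) (f : V → ℕ+) (σ : Equiv.Perm V) (hf : ∀ x, f x = f (σ x)) :
    phi (colE E f) σ = phi E σ := by
  classical
  unfold phi
  refine Finset.sum_congr (Finset.filter_congr fun c hc => ?_) fun _ _ => rfl
  rw [cyc_col E f hc]
  exact ⟨fun h => h.1, fun h => ⟨h, fun x _ => hf x⟩⟩

open Classical in
theorem power_expansion (E : Set (V × V)) (f : V → ℕ+) :
    (redeiBergeCount E f : ℚ) = ∑ σ : Equiv.Perm V,
      if MemSVXXbar E σ ∧ (∀ x, f x = f (σ x)) then (-1 : ℚ) ^ phi E σ else 0 := by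
  rw [count_listing_eq, core]
  refine Finset.sum_congr rfl fun σ _ => ?_
  by_cases h : MemSVXXbar E σ ∧ (∀ x, f x = f (σ x))
  · rw [if_pos h, if_pos ((mem_col E f σ).2 h), phi_col E f σ h.2]
  · rw [if_neg h, if_neg (fun h' => h ((mem_col E f σ).1 h'))]

end RB

namespace RB
open Finset
variable {V : Type*} [DecidableEq V] [Fintype V]

lemma sign_eq (σ : Equiv.Perm V) :
    Equiv.Perm.sign σ = ∏ s ∈ orbs σ, (-(-1 : ℤˣ) ^ s.card) := by
  rw [Equiv.Perm.sign_of_cycleType', Equiv.Perm.cycleType_def, Multiset.map_map]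
  change ∏ c ∈ σ.cycleFactorsFinset, (-(-1 : ℤˣ) ^ c.support.card) = _
  rw [← Finset.prod_image (s := σ.cycleFactorsFinset)
    (g := fun c => c.support) (f := fun s => (-(-1 : ℤˣ) ^ s.card))]
  · refine Finset.prod_subset ?_ ?_
    · intro s hs
      obtain ⟨c, hc, rfl⟩ := mem_image.1 hs
      have hcyc := (Equiv.Perm.mem_cycleFactorsFinset_iff.1 hc).1
      obtain ⟨x, hx⟩ := hcyc.nonempty_support
      rw [support_eq_orb hc hx]
      exact mem_image_of_mem _ (mem_univ _)
    · intro s hs hns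
      obtain ⟨x, _, rfl⟩ := mem_image.1 hs
      by_cases hfix : σ x = x
      · rw [fixed_orb hfix]; simp
      · obtain ⟨c, hc, hxc, hcs⟩ := exists_cycle hfix
        exact absurd (mem_image.2 ⟨c, hc, hcs⟩) hns
  · intro c hc d hd h
    exact support_inj (mem_coe.1 hc) (mem_coe.1 hd) h

lemma sign_type {σ τ : Equiv.Perm V} (h : typeSetoid σ = typeSetoid τ) :
    Equiv.Perm.sign σ = Equiv.Perm.sign τ := by
  rw [sign_eq, sign_eq]
  have : orb σ = orb τ := by
    funext x
    ext y
    rw [mem_orb, mem_orb]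
    have := congrArg (fun s : Setoid V => s x y) h
    exact iff_of_eq this
  unfold orbs
  rw [this]

lemma type_le_iff {σ : Equiv.Perm V} {τ : Setoid V} :
    typeSetoid σ ≤ τ ↔ ∀ x, τ x (σ x) := by
  constructor
  · intro h x
    exact h (show σ.SameCycle x (σ x) from Equiv.Perm.sameCycle_apply_right.2 (.refl _ _))
  · intro h x y hxy
    obtain ⟨k, rfl⟩ := Equiv.Perm.SameCycle.exists_nat_pow_eq (show σ.SameCycle x y from hxy)
    induction k with
    | zero => exact τ.refl' x
    | succ k ih =>
      rw [pow_succ', Equiv.Perm.mul_apply]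
      exact τ.trans' (ih ⟨k, by simp⟩) (h _)

open Classical in
lemma sum_sign [Fintype (Setoid V)] (τ : Setoid V) :
    ∑ σ : Equiv.Perm V, (if typeSetoid σ ≤ τ then ((Equiv.Perm.sign σ : ℤ) : ℚ) else 0) =
      if τ = ⊥ then 1 else 0 := by
  simp only [type_le_iff]
  split_ifs with h
  · subst h
    rw [Finset.sum_eq_single 1]
    · rw [if_pos]
      · simp
      · intro x; exact Setoid.refl' _ x
    · intro σ _ hne
      rw [if_neg]
      intro h
      apply hne
      ext x
      exact (h x).symm
    · simp
  · have : ∃ x y, τ x y ∧ x ≠ y := by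
      by_contra hc
      push Not at hc
      apply h
      rw [eq_bot_iff]
      intro x y hxy
      exact hc x y hxy
    obtain ⟨x, y, hxy, hne⟩ := this
    have hsw : ∀ z, τ z (Equiv.swap x y z) := by
      intro z
      rw [Equiv.swap_apply_def]
      split_ifs with h1 h2
      · rw [h1]; exact hxy
      · rw [h2]; exact τ.symm' hxy
      · exact τ.refl' z
    have hiff : ∀ σ : Equiv.Perm V, (∀ z, τ z ((σ * Equiv.swap x y) z)) ↔ ∀ z, τ z (σ z) := by
      intro σ
      constructor
      · intro h z
        have := h (Equiv.swap x y z)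
        rw [Equiv.Perm.mul_apply, Equiv.swap_apply_self] at this
        exact τ.trans' (hsw z) this
      · intro h z
        exact τ.trans' (hsw z) (h _)
    refine Finset.sum_involution (fun σ _ => σ * Equiv.swap x y) ?_ ?_ ?_ ?_
    · intro σ _
      simp only [hiff]
      split_ifs
      · simp [Equiv.Perm.sign_swap hne]
      · simp
    · intro σ _ _ he
      have : Equiv.swap x y = 1 := by simpa using he
      exact hne (Equiv.swap_eq_one_iff.1 this)
    · intro σ _; exact mem_univ _
    · intro σ _; simp [mul_assoc]

open Classical in
lemma zeta_inj {P : Type*} [PartialOrder P] [Fintype P] {u w : P → ℚ}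
    (h : ∀ τ, ∑ ρ, (if ρ ≤ τ then u ρ else 0) = ∑ ρ, (if ρ ≤ τ then w ρ else 0)) : u = w := by
  funext τ
  induction τ using WellFoundedLT.induction with
  | _ τ ih =>
    have h1 := h τ
    rw [← Finset.add_sum_erase _ _ (mem_univ τ), ← Finset.add_sum_erase univ _ (mem_univ τ)] at h1
    have h2 : ∑ ρ ∈ univ.erase τ, (if ρ ≤ τ then u ρ else 0) =
        ∑ ρ ∈ univ.erase τ, (if ρ ≤ τ then w ρ else 0) := by
      refine Finset.sum_congr rfl fun ρ hρ => ?_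
      split_ifs with hle
      · exact ih ρ (lt_of_le_of_ne hle (ne_of_mem_erase hρ))
      · rfl
    rw [h2] at h1
    have h3 := add_right_cancel h1
    rwa [if_pos le_rfl, if_pos le_rfl] at h3

section mobius
variable [Fintype (Setoid V)] (μ : Setoid V → Setoid V → ℚ)

open Classical in
lemma mob_sum (hd : ∀ a : Setoid V, μ a a = 1)
    (hs : ∀ a b : Setoid V, a < b →
      ∑ c : Setoid V, (if a ≤ c ∧ c ≤ b then μ a c else 0) = 0)
    (hz : ∀ a b : Setoid V, ¬a ≤ b → μ a b = 0) (a b : Setoid V) :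
    ∑ c, (if c ≤ b then μ a c else 0) = if a = b then 1 else 0 := by
  have h0 : ∀ c, (if c ≤ b then μ a c else 0) = if a ≤ c ∧ c ≤ b then μ a c else 0 := by
    intro c
    by_cases h1 : a ≤ c
    · simp [h1]
    · simp [h1, hz a c h1]
  rw [Finset.sum_congr rfl (fun c _ => h0 c)]
  split_ifs with h
  · subst h
    rw [Finset.sum_eq_single a]
    · simp [hd]
    · intro c _ hne
      rw [if_neg]
      rintro ⟨h1, h2⟩
      exact hne (le_antisymm h2 h1)
    · simp
  · by_cases hab : a ≤ b
    · exact hs a b (lt_of_le_of_ne hab h)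
    · refine Finset.sum_eq_zero fun c _ => ?_
      rw [if_neg]
      rintro ⟨h1, h2⟩
      exact hab (h1.trans h2)

open Classical in
lemma weisner (hm : ∀ a b : Setoid V,
      ∑ c, (if c ≤ b then μ a c else 0) = if a = b then 1 else 0) (κ ρ : Setoid V) :
    ∑ π, (if π ⊓ κ = ⊥ then μ π ρ else 0) = if ρ ≤ κ then μ ⊥ ρ else 0 := by
  refine congrFun (zeta_inj (u := fun ρ => ∑ π, (if π ⊓ κ = ⊥ then μ π ρ else 0))
    (w := fun ρ => if ρ ≤ κ then μ ⊥ ρ else 0) ?_) ρ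
  intro τ
  have hl : ∑ ρ, (if ρ ≤ τ then ∑ π, (if π ⊓ κ = ⊥ then μ π ρ else 0) else 0) =
      if τ ⊓ κ = ⊥ then 1 else 0 := by
    have h1 : ∀ ρ, (if ρ ≤ τ then ∑ π, (if π ⊓ κ = ⊥ then μ π ρ else 0) else 0) =
        ∑ π, (if π ⊓ κ = ⊥ then (if ρ ≤ τ then μ π ρ else 0) else 0) := by
      intro ρ
      by_cases h : ρ ≤ τ <;> simp [h]
    rw [Finset.sum_congr rfl (fun ρ _ => h1 ρ), Finset.sum_comm]
    have h2 : ∀ π : Setoid V, ∑ ρ, (if π ⊓ κ = ⊥ then (if ρ ≤ τ then μ π ρ else 0) else 0) =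
        if π = τ then (if τ ⊓ κ = ⊥ then 1 else 0) else 0 := by
      intro π
      by_cases h : π ⊓ κ = ⊥
      · simp only [h, if_true]
        rw [hm]
        by_cases h' : π = τ
        · subst h'; simp [h]
        · simp [h']
      · by_cases h' : π = τ
        · subst h'; simp [h]
        · simp [h, h']
    rw [Finset.sum_congr rfl (fun π _ => h2 π)]
    simp
  have hr : ∑ ρ, (if ρ ≤ τ then (if ρ ≤ κ then μ ⊥ ρ else 0) else 0) =
      if τ ⊓ κ = ⊥ then 1 else 0 := by
    have := hm ⊥ (τ ⊓ κ)
    simp only [le_inf_iff] at this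
    simp only [← ite_and, this]
    exact if_congr eq_comm rfl rfl
  exact hl.trans hr.symm

open Classical in
lemma mob_ne_zero (hm : ∀ a b : Setoid V,
      ∑ c, (if c ≤ b then μ a c else 0) = if a = b then 1 else 0) (σ : Equiv.Perm V) :
    μ ⊥ (typeSetoid σ) ≠ 0 := by
  have key : μ ⊥ = fun ρ => ∑ τ : Equiv.Perm V,
      if typeSetoid τ = ρ then ((Equiv.Perm.sign τ : ℤ) : ℚ) else 0 := by
    apply zeta_inj
    intro b
    rw [hm]
    have h1 : ∀ ρ : Setoid V, (if ρ ≤ b then ∑ τ : Equiv.Perm V,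
        (if typeSetoid τ = ρ then ((Equiv.Perm.sign τ : ℤ) : ℚ) else 0) else 0) =
        ∑ τ : Equiv.Perm V, if typeSetoid τ = ρ then
          (if typeSetoid τ ≤ b then ((Equiv.Perm.sign τ : ℤ) : ℚ) else 0) else 0 := by
      intro ρ
      by_cases h : ρ ≤ b
      · rw [if_pos h]
        refine Finset.sum_congr rfl fun τ _ => ?_
        by_cases h' : typeSetoid τ = ρ
        · simp [h', h]
        · simp [h']
      · rw [if_neg h]
        symm
        refine Finset.sum_eq_zero fun τ _ => ?_
        by_cases h' : typeSetoid τ = ρ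
        · simp [h', h]
        · simp [h']
    rw [Finset.sum_congr rfl (fun ρ _ => h1 ρ), Finset.sum_comm]
    simp only [Finset.sum_ite_eq, mem_univ, if_true]
    rw [sum_sign]
    exact if_congr eq_comm rfl rfl
  rw [key]
  have h2 : ∑ τ : Equiv.Perm V,
      (if typeSetoid τ = typeSetoid σ then ((Equiv.Perm.sign τ : ℤ) : ℚ) else 0) =
      (univ.filter (fun τ : Equiv.Perm V => typeSetoid τ = typeSetoid σ)).card *
        ((Equiv.Perm.sign σ : ℤ) : ℚ) := by
    rw [← Finset.sum_filter, ← nsmul_eq_mul, ← Finset.sum_const]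
    refine Finset.sum_congr rfl fun τ hτ => ?_
    rw [sign_type (mem_filter.1 hτ).2]
  simp only
  rw [h2]
  refine mul_ne_zero ?_ (by simp)
  rw [Nat.cast_ne_zero]
  exact (Finset.card_pos.2 ⟨σ, by simp⟩).ne'

end mobius
end RB

open Classical in
/-- Elementary basis expansion of the noncommutative Redei–Berge function.  Here `μ` is
the Möbius function of the lattice of set partitions of `V` (ordered by refinement),
characterized by `μ(a, a) = 1`, `Σ_{a ≤ c ≤ b} μ(a, c) = 0` for `a < b`, and `μ(a, b) = 0`
unless `a ≤ b`.  Then `N(f, X) = Σ_π c_π · [f is injective on each block of π]`, where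
`c_π = Σ_{σ ∈ 𝕊_V(X, X̄), π ≤ Type(σ)} (−1)^{φ(σ)} μ(π, Type(σ)) / μ(0̂, Type(σ))`
is the coefficient `[e_π] W_X`. -/
theorem redeiBergeCount_elementary_expansion {V : Type*} [Fintype V] [DecidableEq V]
    [Fintype (Setoid V)] (E : Set (V × V)) (f : V → ℕ+)
    (μ : Setoid V → Setoid V → ℚ)
    (hμ_diag : ∀ a : Setoid V, μ a a = 1)
    (hμ_sum : ∀ a b : Setoid V, a < b →
      ∑ c : Setoid V, (if a ≤ c ∧ c ≤ b then μ a c else 0) = 0)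
    (hμ_not_le : ∀ a b : Setoid V, ¬a ≤ b → μ a b = 0) :
    (redeiBergeCount E f : ℚ) =
      ∑ π : Setoid V,
        (∑ σ : Equiv.Perm V,
          if MemSVXXbar E σ ∧ π ≤ typeSetoid σ then
            (-1 : ℚ) ^ phi E σ * μ π (typeSetoid σ) / μ ⊥ (typeSetoid σ)
          else 0) *
        (if ∀ x y : V, π x y → f x = f y → x = y then 1 else 0) := by

  classical
  have hm := RB.mob_sum μ hμ_diag hμ_sum hμ_not_le
  rw [RB.power_expansion]
  simp only [Finset.sum_mul]
  rw [Finset.sum_comm]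
  refine Finset.sum_congr rfl fun σ _ => ?_
  have hinj : ∀ π : Setoid V, (∀ x y : V, π x y → f x = f y → x = y) ↔ π ⊓ Setoid.ker f = ⊥ := by
    intro π
    rw [eq_bot_iff]
    constructor
    · intro h x y hxy
      exact h x y hxy.1 hxy.2
    · intro h x y hxy hf
      exact h ⟨hxy, hf⟩
  have hker : typeSetoid σ ≤ Setoid.ker f ↔ ∀ x, f x = f (σ x) := RB.type_le_iff
  by_cases hM : MemSVXXbar E σ
  · have hne := RB.mob_ne_zero μ hm σ
    have h1 : ∀ π : Setoid V,
        (if MemSVXXbar E σ ∧ π ≤ typeSetoid σ then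
            (-1 : ℚ) ^ phi E σ * μ π (typeSetoid σ) / μ ⊥ (typeSetoid σ)
          else 0) * (if ∀ x y : V, π x y → f x = f y → x = y then 1 else 0) =
        ((-1 : ℚ) ^ phi E σ / μ ⊥ (typeSetoid σ)) *
          (if π ⊓ Setoid.ker f = ⊥ then μ π (typeSetoid σ) else 0) := by
      intro π
      simp only [hinj π, hM, true_and]
      by_cases hle : π ≤ typeSetoid σ
      · simp only [hle, if_true]
        split_ifs <;> ring
      · simp [hle, hμ_not_le _ _ hle]
    rw [Finset.sum_congr rfl (fun π _ => h1 π), ← Finset.mul_sum, RB.weisner μ hm]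
    simp only [hker, hM, true_and]
    split_ifs
    · field_simp
    · simp
  · simp [hM]
end
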